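/- arXiv:2510.12464 — 4 statements merged into one kernel-verified Lean document; each statement's English description precedes it below -/
import Mathlib

section
/- Let f : ℝ³ × [0,∞) → ℝ be measurable and such that all the integrals below converge absolutely. Then the resonant collision operator satisfies the conservation relations ∫_{ℝ³×[0,∞)} Q_r(f,f)(ξ,I) φ(ξ,I) dξ dI = 0 for each of the functions φ(ξ,I) = 1, φ(ξ,I) = ξ_i (i = 1,2,3), φ(ξ,I) = |ξ|², and φ(ξ,I) = I; in particular the kinetic energy and the internal energy are conserved separately by resonant collisions. -/
noncomputable section

open MeasureTheory Real
open scoped BigOperators RealInnerProductSpace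

abbrev V3 : Type := EuclideanSpace ℝ (Fin 3)

abbrev Sph : Type := Metric.sphere (0 : V3) 1

/-- The surface measure on the unit sphere `S²` (total mass `4π`). -/
def sphMeasure : Measure Sph := (volume : Measure V3).toSphere

/-- The measure `dξ dI` on `ℝ³ × [0,∞)`. -/
def phaseMeasure : Measure (V3 × ℝ) :=
  (volume : Measure V3).prod ((volume : Measure ℝ).restrict (Set.Ici 0))

/-- Total energy `E = (m/4)|ξ−ξ_*|² + I + I_*` in the center-of-mass frame. -/
def collE (m : ℝ) (ξ ξs : V3) (I Is : ℝ) : ℝ :=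
  m / 4 * ‖ξ - ξs‖ ^ 2 + I + Is

/-- Post-collisional velocity `ξ'` for standard (Borgnakke–Larsen) collisions. -/
def xiPrimeStd (m : ℝ) (ξ ξs : V3) (I Is R : ℝ) (σ : Sph) : V3 :=
  (1 / 2 : ℝ) • (ξ + ξs) + Real.sqrt (R * collE m ξ ξs I Is / m) • (σ : V3)

/-- Post-collisional velocity `ξ_*'` for standard collisions. -/
def xiStarPrimeStd (m : ℝ) (ξ ξs : V3) (I Is R : ℝ) (σ : Sph) : V3 :=
  (1 / 2 : ℝ) • (ξ + ξs) - Real.sqrt (R * collE m ξ ξs I Is / m) • (σ : V3)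

/-- Post-collisional internal energy `I' = r(1−R)E` for standard collisions. -/
def IPrimeStd (m : ℝ) (ξ ξs : V3) (I Is R r : ℝ) : ℝ :=
  r * (1 - R) * collE m ξ ξs I Is

/-- Post-collisional internal energy `I_*' = (1−r)(1−R)E` for standard collisions. -/
def IStarPrimeStd (m : ℝ) (ξ ξs : V3) (I Is R r : ℝ) : ℝ :=
  (1 - r) * (1 - R) * collE m ξ ξs I Is

/-- Integrand of the standard collision operator `Q_s`. -/
def stdIntegrand (m δ α β Cs : ℝ) (f F : V3 → ℝ → ℝ)
    (ξ : V3) (I : ℝ) (ξs : V3) (Is : ℝ) (σ : Sph) (r R : ℝ) : ℝ :=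
  ((f (xiPrimeStd m ξ ξs I Is R σ) (IPrimeStd m ξ ξs I Is R r) *
        F (xiStarPrimeStd m ξ ξs I Is R σ) (IStarPrimeStd m ξ ξs I Is R r) +
      f (xiStarPrimeStd m ξ ξs I Is R σ) (IStarPrimeStd m ξ ξs I Is R r) *
        F (xiPrimeStd m ξ ξs I Is R σ) (IPrimeStd m ξ ξs I Is R r)) /
      (IPrimeStd m ξ ξs I Is R r * IStarPrimeStd m ξ ξs I Is R r) ^ (δ / 2 - 1) -
    (f ξ I * F ξs Is + f ξs Is * F ξ I) / (I * Is) ^ (δ / 2 - 1)) *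
  (Cs * (I + Is) ^ α * ‖ξ - ξs‖ ^ β * (I * Is) ^ (δ / 2 - 1) *
    (r * (1 - r)) ^ (δ / 2 - 1) * (1 - R) ^ (α + δ - 1) * R ^ ((β + 1) / 2))

/-- The standard (inelastic) collision operator `Q_s(f,F)`. -/
def Qs (m δ α β Cs : ℝ) (f F : V3 → ℝ → ℝ) (ξ : V3) (I : ℝ) : ℝ :=
  (1 / 2) * ∫ Is in Set.Ici (0 : ℝ), ∫ ξs : V3,
    (∫ σ : Sph, (∫ r in Set.Icc (0 : ℝ) 1, ∫ R in Set.Icc (0 : ℝ) 1,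
      stdIntegrand m δ α β Cs f F ξ I ξs Is σ r R) ∂sphMeasure)

/-- Post-collisional velocity `ξ'` for resonant collisions. -/
def xiPrimeRes (ξ ξs : V3) (σ : Sph) : V3 :=
  (1 / 2 : ℝ) • (ξ + ξs) + (‖ξ - ξs‖ / 2) • (σ : V3)

/-- Post-collisional velocity `ξ_*'` for resonant collisions. -/
def xiStarPrimeRes (ξ ξs : V3) (σ : Sph) : V3 :=
  (1 / 2 : ℝ) • (ξ + ξs) - (‖ξ - ξs‖ / 2) • (σ : V3)

/-- Post-collisional internal energy `I' = r(I+I_*)` for resonant collisions. -/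
def IPrimeRes (I Is r : ℝ) : ℝ := r * (I + Is)

/-- Post-collisional internal energy `I_*' = (1−r)(I+I_*)` for resonant collisions. -/
def IStarPrimeRes (I Is r : ℝ) : ℝ := (1 - r) * (I + Is)

/-- Integrand of the resonant collision operator `Q_r`. -/
def resIntegrand (δ α β Cr : ℝ) (f F : V3 → ℝ → ℝ)
    (ξ : V3) (I : ℝ) (ξs : V3) (Is : ℝ) (σ : Sph) (r : ℝ) : ℝ :=
  ((f (xiPrimeRes ξ ξs σ) (IPrimeRes I Is r) * F (xiStarPrimeRes ξ ξs σ) (IStarPrimeRes I Is r) +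
      f (xiStarPrimeRes ξ ξs σ) (IStarPrimeRes I Is r) * F (xiPrimeRes ξ ξs σ) (IPrimeRes I Is r)) /
      (IPrimeRes I Is r * IStarPrimeRes I Is r) ^ (δ / 2 - 1) -
    (f ξ I * F ξs Is + f ξs Is * F ξ I) / (I * Is) ^ (δ / 2 - 1)) *
  (Cr * (I + Is) ^ α * ‖ξ - ξs‖ ^ β * (I * Is) ^ (δ / 2 - 1) * (r * (1 - r)) ^ (δ / 2 - 1))

/-- The resonant (elastic) collision operator `Q_r(f,F)`. -/
def Qr (δ α β Cr : ℝ) (f F : V3 → ℝ → ℝ) (ξ : V3) (I : ℝ) : ℝ :=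
  (1 / 2) * ∫ Is in Set.Ici (0 : ℝ), ∫ ξs : V3,
    (∫ σ : Sph, (∫ r in Set.Icc (0 : ℝ) 1,
      resIntegrand δ α β Cr f F ξ I ξs Is σ r) ∂sphMeasure)

/-- The Maxwellian equilibrium distribution `M_s`. -/
def Ms (m kB δ n T : ℝ) (u : V3) (ξ : V3) (I : ℝ) : ℝ :=
  n * I ^ (δ / 2 - 1) /
      ((2 * π * kB * T / m) ^ ((3 : ℝ) / 2) * (kB * T) ^ (δ / 2) * Real.Gamma (δ / 2)) *
    Real.exp (-(m * ‖ξ - u‖ ^ 2 + 2 * I) / (2 * kB * T))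

/-- The two-temperature equilibrium distribution `M_r`. -/
def Mr (m kB δ n Ttr Tint : ℝ) (u : V3) (ξ : V3) (I : ℝ) : ℝ :=
  n * I ^ (δ / 2 - 1) /
      ((2 * π * kB * Ttr / m) ^ ((3 : ℝ) / 2) * (kB * Tint) ^ (δ / 2) * Real.Gamma (δ / 2)) *
    Real.exp (-(m * ‖ξ - u‖ ^ 2) / (2 * kB * Ttr) - I / (kB * Tint))

/-- Integrand of the resonant linearized collision operator `L_r`. -/
def LrIntegrand (m kB δ n Ttr Tint α β : ℝ) (u : V3) (h : V3 → ℝ → ℝ)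
    (ξ : V3) (I : ℝ) (Is : ℝ) (ξs : V3) (σ : Sph) (r : ℝ) : ℝ :=
  Mr m kB δ n Ttr Tint u ξs Is *
    (h (xiStarPrimeRes ξ ξs σ) (IStarPrimeRes I Is r) + h (xiPrimeRes ξ ξs σ) (IPrimeRes I Is r) -
      h ξs Is - h ξ I) *
    (I + Is) ^ α * ‖ξ - ξs‖ ^ β * (r * (1 - r)) ^ (δ / 2 - 1)

/-- The resonant linearized collision operator `L_r`. -/
def Lr (m kB δ n Ttr Tint α β Cr : ℝ) (u : V3) (h : V3 → ℝ → ℝ) (ξ : V3) (I : ℝ) : ℝ :=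
  -Cr * ∫ Is in Set.Ici (0 : ℝ), ∫ ξs : V3,
    (∫ σ : Sph, (∫ r in Set.Icc (0 : ℝ) 1,
      LrIntegrand m kB δ n Ttr Tint α β u h ξ I Is ξs σ r) ∂sphMeasure)

/-- The product measure for the full 7-variable integrand of `Q_s`-moments:
variables `(ξ, I, ξ_*, I_*, σ, r, R)`. -/
def stdMeasure : Measure (V3 × ℝ × V3 × ℝ × Sph × ℝ × ℝ) :=
  (volume : Measure V3).prod
    (((volume : Measure ℝ).restrict (Set.Ici 0)).prod
      ((volume : Measure V3).prod
        (((volume : Measure ℝ).restrict (Set.Ici 0)).prod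
          (sphMeasure.prod
            (((volume : Measure ℝ).restrict (Set.Icc 0 1)).prod
              ((volume : Measure ℝ).restrict (Set.Icc 0 1)))))))

/-- The product measure for the full 6-variable integrand of `Q_r`-moments:
variables `(ξ, I, ξ_*, I_*, σ, r)`. -/
def resMeasure : Measure (V3 × ℝ × V3 × ℝ × Sph × ℝ) :=
  (volume : Measure V3).prod
    (((volume : Measure ℝ).restrict (Set.Ici 0)).prod
      ((volume : Measure V3).prod
        (((volume : Measure ℝ).restrict (Set.Ici 0)).prod
          (sphMeasure.prod ((volume : Measure ℝ).restrict (Set.Icc 0 1))))))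

/-- The product measure for the kernel variables `(I_*, ξ_*, σ, r)` of `L_r`. -/
def resKernelMeasure : Measure (ℝ × V3 × Sph × ℝ) :=
  ((volume : Measure ℝ).restrict (Set.Ici 0)).prod
    ((volume : Measure V3).prod (sphMeasure.prod ((volume : Measure ℝ).restrict (Set.Icc 0 1))))

section Products

variable {X Y Z W : Type*} [MeasurableSpace X] [MeasurableSpace Y] [MeasurableSpace Z]
  [MeasurableSpace W]

lemma measurePreserving_prod_left_comm (μ : Measure X) (ν : Measure Y) (κ : Measure Z)
    [SFinite μ] [SFinite ν] [SFinite κ] :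
    MeasurePreserving (fun p : X × Y × Z => (p.2.1, p.1, p.2.2))
      (μ.prod (ν.prod κ)) (ν.prod (μ.prod κ)) :=
  (measurePreserving_prodAssoc ν μ κ).comp
    ((Measure.measurePreserving_swap.prod (MeasurePreserving.id κ)).comp
      (measurePreserving_prodAssoc μ ν κ).symm)

lemma measurePreserving_prodProdProdComm (μ : Measure X) (ν : Measure Y) (κ : Measure Z)
    (τ : Measure W) [SFinite μ] [SFinite ν] [SFinite κ] [SFinite τ] :
    MeasurePreserving (fun p : (X × Y) × Z × W => ((p.1.1, p.2.1), (p.1.2, p.2.2)))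
      ((μ.prod ν).prod (κ.prod τ)) ((μ.prod κ).prod (ν.prod τ)) :=
  (measurePreserving_prodAssoc μ κ (ν.prod τ)).symm.comp
    (((MeasurePreserving.id μ).prod (measurePreserving_prod_left_comm ν κ τ)).comp
      (measurePreserving_prodAssoc μ ν (κ.prod τ)))

lemma integral_prod_four {μ : Measure X} {ν : Measure Y} {κ : Measure Z} {τ : Measure W}
    [SFinite μ] [SFinite ν] [SFinite κ] [SFinite τ] {g : X × Y × Z × W → ℝ}
    (hg : Integrable g (μ.prod (ν.prod (κ.prod τ)))) :
    ∫ p, g p ∂(μ.prod (ν.prod (κ.prod τ))) =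
      ∫ x, ∫ y, ∫ z, ∫ w, g (x, y, z, w) ∂τ ∂κ ∂ν ∂μ := by
  rw [integral_prod _ hg]
  refine integral_congr_ae ?_
  filter_upwards [hg.prod_right_ae] with x hx
  rw [integral_prod _ hx]
  refine integral_congr_ae ?_
  filter_upwards [hx.prod_right_ae] with y hy
  exact integral_prod _ hy

lemma integral_prod_four_swap {μ : Measure X} {ν : Measure Y} {κ : Measure Z} {τ : Measure W}
    [SFinite μ] [SFinite ν] [SFinite κ] [SFinite τ] {g : X × Y × Z × W → ℝ}
    (hg : Integrable g (μ.prod (ν.prod (κ.prod τ)))) :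
    ∫ p, g p ∂(μ.prod (ν.prod (κ.prod τ))) =
      ∫ y, ∫ x, ∫ z, ∫ w, g (x, y, z, w) ∂τ ∂κ ∂μ ∂ν := by
  have h := measurePreserving_prod_left_comm ν μ (κ.prod τ)
  rw [← h.map_eq, integral_map h.aemeasurable (h.map_eq ▸ hg.aestronglyMeasurable)]
  exact integral_prod_four (h.integrable_comp_of_integrable hg)

end Products

instance : IsFiniteMeasure sphMeasure := by
  unfold sphMeasure
  infer_instance

/-- The density `ρ² dρ` of the modulus of the relative velocity. -/
def radMeasure : Measure (Set.Ioi (0 : ℝ)) := .volumeIoiPow (Module.finrank ℝ V3 - 1)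

instance : SigmaFinite radMeasure := by
  unfold radMeasure
  infer_instance

/-- The density `E dE` of the total internal energy. -/
def energyMeasure : Measure ℝ :=
  (volume.restrict (Set.Ioi 0)).withDensity ENNReal.ofReal

instance : SFinite energyMeasure := by
  unfold energyMeasure
  infer_instance

lemma measurePreserving_polar :
    MeasurePreserving (fun p : Sph × Set.Ioi (0 : ℝ) => (p.2 : ℝ) • (p.1 : V3))
      (sphMeasure.prod radMeasure) volume := by
  have h1 := (volume : Measure V3).measurePreserving_homeomorphUnitSphereProd
  have h2 := MeasurePreserving.symm (homeomorphUnitSphereProd V3).toMeasurableEquiv h1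
  have h3 := measurePreserving_subtype_coe (μa := (volume : Measure V3))
    (measurableSet_singleton (0 : V3)).compl
  rw [restrict_compl_singleton] at h3
  exact h3.comp h2

lemma measurePreserving_centerOfMass :
    MeasurePreserving (fun p : V3 × V3 =>
        (p.1 + (1 / 2 : ℝ) • p.2, p.1 - (1 / 2 : ℝ) • p.2))
      (volume.prod volume) (volume.prod volume) := by
  have h1 : MeasurePreserving (fun p : V3 × V3 => (p.1, p.2 + (1 / 2 : ℝ) • p.1))
      (volume.prod volume) (volume.prod volume) :=
    (MeasurePreserving.id volume).skew_product (g := fun w c => c + (1 / 2 : ℝ) • w)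
      (by simp only [Function.uncurry_def]; fun_prop)
      (.of_forall fun w => (measurePreserving_add_right volume _).map_eq)
  have h2 : MeasurePreserving (fun p : V3 × V3 => (p.1, p.1 - p.2))
      (volume.prod volume) (volume.prod volume) :=
    (MeasurePreserving.id volume).skew_product (g := fun x w => x - w)
      (by simp only [Function.uncurry_def]; fun_prop)
      (.of_forall fun x => (Measure.measurePreserving_sub_left volume x).map_eq)
  convert h2.comp (Measure.measurePreserving_swap.comp
    (h1.comp Measure.measurePreserving_swap)) using 1
  ext1 p
  simp only [Function.comp_apply, Prod.fst_swap, Prod.snd_swap, Prod.swap_prod_mk, Prod.mk.injEq,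
    true_and]
  module

/-- Pre-collisional velocities in terms of direction, center of mass and modulus. -/
lemma measurePreserving_velocities :
    MeasurePreserving (fun p : Sph × V3 × Set.Ioi (0 : ℝ) =>
        (p.2.1 + ((p.2.2 : ℝ) / 2) • (p.1 : V3), p.2.1 - ((p.2.2 : ℝ) / 2) • (p.1 : V3)))
      (sphMeasure.prod (volume.prod radMeasure)) (volume.prod volume) := by
  convert measurePreserving_centerOfMass.comp
    (((MeasurePreserving.id volume).prod measurePreserving_polar).comp
      (measurePreserving_prod_left_comm sphMeasure volume radMeasure)) using 1
  ext1 p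
  simp only [Function.comp_apply, Prod.map_apply, id, smul_smul, div_eq_inv_mul, mul_one]

lemma measurePreserving_energy_scaling :
    MeasurePreserving (fun p : ℝ × ℝ => (p.2, p.1 * p.2))
      ((volume.restrict (Set.Icc 0 1)).prod energyMeasure)
      ((volume.prod volume).restrict {p : ℝ × ℝ | 0 ≤ p.2 ∧ p.2 ≤ p.1}) := by
  have hT : MeasurableSet {p : ℝ × ℝ | 0 ≤ p.2 ∧ p.2 ≤ p.1} :=
    (measurableSet_le measurable_const measurable_snd).inter
      (measurableSet_le measurable_snd measurable_fst)
  have hm : Measurable (fun p : ℝ × ℝ => (p.2, p.1 * p.2)) := by fun_prop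
  refine ⟨hm, Measure.ext fun s hs => ?_⟩
  rw [Measure.map_apply hm hs, Measure.prod_apply_symm (hm hs), Measure.restrict_apply hs,
    Measure.prod_apply (hs.inter hT), energyMeasure,
    lintegral_withDensity_eq_lintegral_mul₀ (by fun_prop)
      (measurable_measure_prodMk_right (hm hs)).aemeasurable,
    ← setLIntegral_eq_of_support_subset (s := Set.Ici 0)
      (f := fun E => volume (Prod.mk E ⁻¹' (s ∩ {p : ℝ × ℝ | 0 ≤ p.2 ∧ p.2 ≤ p.1}))),
    ← setLIntegral_congr Ioi_ae_eq_Ici]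
  · refine setLIntegral_congr_fun measurableSet_Ioi fun E (hE : 0 < E) => ?_
    simp only [Pi.mul_apply]
    rw [Measure.restrict_apply (measurable_prodMk_right (hm hs))]
    have : (fun x => (x, E)) ⁻¹' ((fun p : ℝ × ℝ => (p.2, p.1 * p.2)) ⁻¹' s) ∩ Set.Icc 0 1 =
        (fun x => x * E) ⁻¹' (Prod.mk E ⁻¹' (s ∩ {p : ℝ × ℝ | 0 ≤ p.2 ∧ p.2 ≤ p.1})) := by
      ext x
      simp only [Set.mem_inter_iff, Set.mem_preimage, Set.mem_Icc, Set.mem_ofPred_eq,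
        mul_nonneg_iff_of_pos_right hE, mul_le_iff_le_one_left hE]
    rw [this, Real.volume_preimage_mul_right hE.ne', abs_of_pos (inv_pos.2 hE), ← mul_assoc,
      ← ENNReal.ofReal_mul hE.le, mul_inv_cancel₀ hE.ne', ENNReal.ofReal_one, one_mul]
  · intro E hE
    by_contra h
    refine hE (measure_mono_null ?_ measure_empty)
    rintro x ⟨-, h1, h2⟩
    exact h (h1.trans h2)

/-- Pre-collisional internal energies in terms of the fraction and the total energy. -/
lemma measurePreserving_energies :
    MeasurePreserving (fun p : ℝ × ℝ => (p.1 * p.2, (1 - p.1) * p.2))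
      ((volume.restrict (Set.Icc 0 1)).prod energyMeasure)
      ((volume.restrict (Set.Ici 0)).prod (volume.restrict (Set.Ici 0))) := by
  have h1 : MeasurePreserving (fun p : ℝ × ℝ => (p.1, p.2 - p.1))
      (volume.prod volume) (volume.prod volume) :=
    (MeasurePreserving.id volume).skew_product (g := fun x w => w - x)
      (by simp only [Function.uncurry_def]; fun_prop)
      (.of_forall fun x => (measurePreserving_sub_right volume x).map_eq)
  have h2 := (h1.comp Measure.measurePreserving_swap).restrict_preimage
    ((measurableSet_Ici (a := (0 : ℝ))).prod (measurableSet_Ici (a := (0 : ℝ))))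
  have h3 : ((fun p : ℝ × ℝ => (p.1, p.2 - p.1)) ∘ Prod.swap) ⁻¹' (Set.Ici 0 ×ˢ Set.Ici 0) =
      {p : ℝ × ℝ | 0 ≤ p.2 ∧ p.2 ≤ p.1} := by
    ext p
    simp
  rw [h3, ← Measure.prod_restrict] at h2
  convert h2.comp measurePreserving_energy_scaling using 1
  ext1 p
  simp [sub_mul]

/-- Angular and energy-splitting parameters. -/
def splitMeasure : Measure (Sph × ℝ) := sphMeasure.prod (volume.restrict (Set.Icc 0 1))

instance : SFinite splitMeasure := by
  unfold splitMeasure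
  infer_instance

instance : SFinite phaseMeasure := by
  unfold phaseMeasure
  infer_instance

/-- The variables `((ξ, I), (ξ_*, I_*), (σ, r))` of a collision. -/
abbrev CollisionSpace : Type := (V3 × ℝ) × (V3 × ℝ) × Sph × ℝ

/-- The measure `resMeasure` with the variables of each particle grouped together. -/
def collisionMeasure : Measure CollisionSpace :=
  phaseMeasure.prod (phaseMeasure.prod splitMeasure)

lemma measurePreserving_flatten :
    MeasurePreserving (fun x : CollisionSpace => (x.1.1, x.1.2, x.2.1.1, x.2.1.2, x.2.2))
      collisionMeasure resMeasure :=
  (measurePreserving_prodAssoc _ _ _).comp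
    ((MeasurePreserving.id phaseMeasure).prod (measurePreserving_prodAssoc _ _ splitMeasure))

/-- The space of collision parameters `(((ω, r₀), (c, ρ), E), (σ, r))`. -/
abbrev CollisionParam : Type := ((Sph × ℝ) × (V3 × Set.Ioi (0 : ℝ)) × ℝ) × Sph × ℝ

/-- The measure on collision parameters corresponding to `collisionMeasure`. -/
def paramMeasure : Measure CollisionParam :=
  (splitMeasure.prod ((volume.prod radMeasure).prod energyMeasure)).prod splitMeasure

/-- The collision variables in terms of the parameters. -/
def ofParam (q : CollisionParam) : CollisionSpace :=
  ((q.1.2.1.1 + ((q.1.2.1.2 : ℝ) / 2) • (q.1.1.1 : V3), q.1.1.2 * q.1.2.2),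
    (q.1.2.1.1 - ((q.1.2.1.2 : ℝ) / 2) • (q.1.1.1 : V3), (1 - q.1.1.2) * q.1.2.2), q.2)

/-- Exchange of pre- and post-collisional configurations. -/
def collisionSwap (q : CollisionParam) : CollisionParam := ((q.2, q.1.2), q.1.1)

lemma measurePreserving_collisionSwap :
    MeasurePreserving collisionSwap paramMeasure paramMeasure :=
  (measurePreserving_prodAssoc splitMeasure
    ((volume.prod radMeasure).prod energyMeasure) splitMeasure).symm.comp
    (((MeasurePreserving.id splitMeasure).prod Measure.measurePreserving_swap).comp
      Measure.measurePreserving_swap)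

lemma measurePreserving_ofParam :
    MeasurePreserving ofParam paramMeasure collisionMeasure := by
  have h1 := measurePreserving_prodProdProdComm sphMeasure (volume.restrict (Set.Icc (0 : ℝ) 1))
    ((volume : Measure V3).prod radMeasure) energyMeasure
  have h2 := measurePreserving_prodProdProdComm (volume : Measure V3) (volume : Measure V3)
    (volume.restrict (Set.Ici (0 : ℝ))) (volume.restrict (Set.Ici (0 : ℝ)))
  have : SFinite (sphMeasure.prod ((volume : Measure V3).prod radMeasure)) :=
    Measure.prod.instSFinite
  have : SFinite ((sphMeasure.prod (volume.restrict (Set.Icc (0 : ℝ) 1))).prod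
      (((volume : Measure V3).prod radMeasure).prod energyMeasure)) := Measure.prod.instSFinite
  have h3 := h2.comp ((measurePreserving_velocities.prod measurePreserving_energies).comp h1)
  exact (measurePreserving_prodAssoc phaseMeasure phaseMeasure splitMeasure).comp
    (h3.prod (MeasurePreserving.id splitMeasure))

/-- The integrand of the collision operator on the space of collisions. -/
def collisionIntegrand (δ α β Cr : ℝ) (f : V3 → ℝ → ℝ) (x : CollisionSpace) : ℝ :=
  resIntegrand δ α β Cr f f x.1.1 x.1.2 x.2.1.1 x.2.1.2 x.2.2.1 x.2.2.2

lemma collisionIntegrand_particleSwap (δ α β Cr : ℝ) (f : V3 → ℝ → ℝ) (x : CollisionSpace) :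
    collisionIntegrand δ α β Cr f (x.2.1, x.1, x.2.2) = collisionIntegrand δ α β Cr f x := by
  simp only [collisionIntegrand, resIntegrand, xiPrimeRes, xiStarPrimeRes, IPrimeRes, IStarPrimeRes,
    norm_sub_rev x.2.1.1 x.1.1, add_comm x.2.1.1 x.1.1, add_comm x.2.1.2 x.1.2,
    mul_comm x.2.1.2 x.1.2]
  ring

lemma collisionIntegrand_collisionSwap (δ α β Cr : ℝ) (f : V3 → ℝ → ℝ) (q : CollisionParam)
    (hr₀ : q.1.1.2 ∈ Set.Icc (0 : ℝ) 1) (hr : q.2.2 ∈ Set.Icc (0 : ℝ) 1) :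
    collisionIntegrand δ α β Cr f (ofParam (collisionSwap q)) = -collisionIntegrand δ α β Cr f (ofParam q) := by
  obtain ⟨⟨⟨ω, s⟩, ⟨c, ρ, hρ : 0 < ρ⟩, E⟩, σ, r⟩ := q
  have hc (ω : Sph) : (1 / 2 : ℝ) • (c + (ρ / 2) • (ω : V3) + (c - (ρ / 2) • (ω : V3))) = c := by
    module
  have hn (ω : Sph) : ‖c + (ρ / 2) • (ω : V3) - (c - (ρ / 2) • (ω : V3))‖ = ρ := by
    have h : c + (ρ / 2) • (ω : V3) - (c - (ρ / 2) • (ω : V3)) = ρ • (ω : V3) := by module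
    rw [h, norm_smul, norm_eq_of_mem_sphere ω, mul_one, Real.norm_of_nonneg hρ.le]
  have hE (r : ℝ) : r * E + (1 - r) * E = E := by ring
  have hrpow {r : ℝ} (hr : r ∈ Set.Icc (0 : ℝ) 1) : (r * E * ((1 - r) * E)) ^ (δ / 2 - 1) =
      (r * (1 - r)) ^ (δ / 2 - 1) * (E ^ 2) ^ (δ / 2 - 1) := by
    rw [← Real.mul_rpow (mul_nonneg hr.1 (sub_nonneg.2 hr.2)) (sq_nonneg E)]
    ring_nf
  simp only [collisionIntegrand, resIntegrand, xiPrimeRes, xiStarPrimeRes, IPrimeRes, IStarPrimeRes, ofParam,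
    collisionSwap, hc, hn, hE]
  rw [hrpow hr₀, hrpow hr]
  ring

lemma ae_mem_Icc_paramMeasure :
    ∀ᵐ q ∂paramMeasure, q.1.1.2 ∈ Set.Icc (0 : ℝ) 1 ∧ q.2.2 ∈ Set.Icc (0 : ℝ) 1 := by
  have h : ∀ᵐ p ∂splitMeasure, p.2 ∈ Set.Icc (0 : ℝ) 1 :=
    Measure.quasiMeasurePreserving_snd.ae (ae_restrict_mem measurableSet_Icc)
  exact (Measure.quasiMeasurePreserving_fst.ae (Measure.quasiMeasurePreserving_fst.ae h)).and
    (Measure.quasiMeasurePreserving_snd.ae h)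

/-- Weak form of the collision operator. -/
lemma integral_Qr_mul (δ α β Cr : ℝ) (f φ : V3 → ℝ → ℝ)
    (hG : Integrable (fun x => collisionIntegrand δ α β Cr f x * φ x.1.1 x.1.2) collisionMeasure) :
    ∫ p, Qr δ α β Cr f f p.1 p.2 * φ p.1 p.2 ∂phaseMeasure =
      (1 / 2) * ∫ x, collisionIntegrand δ α β Cr f x * φ x.1.1 x.1.2 ∂collisionMeasure := by
  rw [collisionMeasure, integral_prod _ hG, ← integral_const_mul]
  refine integral_congr_ae ?_
  filter_upwards [hG.prod_right_ae] with p hp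
  have h := (measurePreserving_prodAssoc (volume : Measure V3)
    ((volume : Measure ℝ).restrict (Set.Ici 0)) splitMeasure).symm
  rw [phaseMeasure] at hp ⊢
  have hp' := h.integrable_comp_of_integrable hp
  rw [splitMeasure] at hp'
  rw [← h.integral_comp', splitMeasure]
  erw [integral_prod_four_swap hp']
  simp only [Qr, collisionIntegrand, mul_assoc, ← integral_mul_const]
  rfl

/-- The collision operator is orthogonal to every collision invariant. -/
lemma integral_Qr_mul_eq_zero (δ α β Cr : ℝ) (f φ : V3 → ℝ → ℝ)
    (hint : Integrable (fun p : V3 × ℝ × V3 × ℝ × Sph × ℝ =>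
        resIntegrand δ α β Cr f f p.1 p.2.1 p.2.2.1 p.2.2.2.1 p.2.2.2.2.1
            p.2.2.2.2.2 * φ p.1 p.2.1) resMeasure)
    (hφ : ∀ (c : V3) (ρ E r s : ℝ) (ω σ : Sph),
      φ (c + ρ • (ω : V3)) (r * E) + φ (c - ρ • (ω : V3)) ((1 - r) * E) =
        φ (c + ρ • (σ : V3)) (s * E) + φ (c - ρ • (σ : V3)) ((1 - s) * E)) :
    ∫ p, Qr δ α β Cr f f p.1 p.2 * φ p.1 p.2 ∂phaseMeasure = 0 := by
  have hG : Integrable (fun x => collisionIntegrand δ α β Cr f x * φ x.1.1 x.1.2) collisionMeasure :=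
    measurePreserving_flatten.integrable_comp_of_integrable hint
  have hS : MeasurePreserving (fun x : CollisionSpace => (x.2.1, x.1, x.2.2))
      collisionMeasure collisionMeasure := measurePreserving_prod_left_comm _ _ _
  have hG' : Integrable (fun x => collisionIntegrand δ α β Cr f x * φ x.2.1.1 x.2.1.2) collisionMeasure := by
    simpa only [Function.comp_def, collisionIntegrand_particleSwap] using hS.integrable_comp_of_integrable hG
  have hswap : ∫ x, collisionIntegrand δ α β Cr f x * φ x.2.1.1 x.2.1.2 ∂collisionMeasure =
      ∫ x, collisionIntegrand δ α β Cr f x * φ x.1.1 x.1.2 ∂collisionMeasure := by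
    conv_rhs => rw [← hS.map_eq]
    rw [integral_map hS.aemeasurable (hS.map_eq.symm ▸ hG.aestronglyMeasurable)]
    simp only [collisionIntegrand_particleSwap]
  set H : CollisionSpace → ℝ := fun x =>
    collisionIntegrand δ α β Cr f x * φ x.1.1 x.1.2 + collisionIntegrand δ α β Cr f x * φ x.2.1.1 x.2.1.2 with hH
  have hHi : Integrable H collisionMeasure := hG.add hG'
  have hHp := measurePreserving_ofParam.integrable_comp_of_integrable hHi
  have hanti : ∫ q, H (ofParam (collisionSwap q)) ∂paramMeasure =
      -∫ q, H (ofParam q) ∂paramMeasure := by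
    rw [← integral_neg]
    refine integral_congr_ae ?_
    filter_upwards [ae_mem_Icc_paramMeasure] with q hq
    simp only [hH, ← mul_add, collisionIntegrand_collisionSwap δ α β Cr f q hq.1 hq.2, neg_mul]
    congr 2
    exact hφ _ _ _ _ _ _ _
  have hcomp : ∫ q, H (ofParam (collisionSwap q)) ∂paramMeasure =
      ∫ q, H (ofParam q) ∂paramMeasure := by
    have hC := measurePreserving_collisionSwap
    conv_rhs => rw [← hC.map_eq]
    exact (integral_map hC.aemeasurable (hC.map_eq.symm ▸ hHp.aestronglyMeasurable)).symm
  have hparam : ∫ x, H x ∂collisionMeasure = ∫ q, H (ofParam q) ∂paramMeasure := by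
    have hP := measurePreserving_ofParam
    rw [← hP.map_eq]
    exact integral_map hP.aemeasurable (hP.map_eq.symm ▸ hHi.aestronglyMeasurable)
  have hsum : ∫ x, H x ∂collisionMeasure = 2 * ∫ x, collisionIntegrand δ α β Cr f x * φ x.1.1 x.1.2
      ∂collisionMeasure := by
    rw [hH, integral_add hG hG', hswap, two_mul]
  rw [integral_Qr_mul δ α β Cr f φ hG]
  linarith

/-- conservation of mass, momentum, kinetic energy and internal energy
(separately) by the resonant collision operator `Q_r`. -/
theorem Qr_conservation (m kB δ α β Cr : ℝ) (hm : 0 < m) (hkB : 0 < kB) (hδ : 2 ≤ δ)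
    (hα : α ∈ Set.Ico (0:ℝ) (δ / 2)) (hβ : β ∈ Set.Icc (0:ℝ) 1) (hCr : 0 < Cr)
    (f : V3 → ℝ → ℝ) (hf : Measurable (Function.uncurry f))
    (hint : ∀ φ : V3 → ℝ → ℝ,
      ((φ = fun _ _ => 1) ∨ (∃ i : Fin 3, φ = fun ξ _ => ξ i) ∨
        (φ = fun ξ _ => ‖ξ‖ ^ 2) ∨ (φ = fun _ I => I)) →
      Integrable (fun p : V3 × ℝ × V3 × ℝ × Sph × ℝ =>
        resIntegrand δ α β Cr f f p.1 p.2.1 p.2.2.1 p.2.2.2.1 p.2.2.2.2.1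
            p.2.2.2.2.2 * φ p.1 p.2.1) resMeasure) :
    (∫ p, Qr δ α β Cr f f p.1 p.2 ∂phaseMeasure) = 0 ∧
    (∀ i : Fin 3, (∫ p, Qr δ α β Cr f f p.1 p.2 * p.1 i ∂phaseMeasure) = 0) ∧
    (∫ p, Qr δ α β Cr f f p.1 p.2 * ‖p.1‖ ^ 2 ∂phaseMeasure) = 0 ∧
    (∫ p, Qr δ α β Cr f f p.1 p.2 * p.2 ∂phaseMeasure) = 0 := by
  have hinv (φ : V3 → ℝ → ℝ) := integral_Qr_mul_eq_zero δ α β Cr f φ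
  refine ⟨?_, fun i => ?_, ?_, ?_⟩
  · simpa only [mul_one] using hinv (fun _ _ => 1) (hint _ (.inl rfl)) (by simp)
  · refine hinv (fun ξ _ => ξ i) (hint _ (.inr (.inl ⟨i, rfl⟩))) fun c ρ E r s ω σ => ?_
    simp only [PiLp.add_apply, PiLp.sub_apply]
    ring
  · refine hinv (fun ξ _ => ‖ξ‖ ^ 2) (hint _ (.inr (.inr (.inl rfl)))) fun c ρ E r s ω σ => ?_
    have h (ω : Sph) : ‖c + ρ • (ω : V3)‖ ^ 2 + ‖c - ρ • (ω : V3)‖ ^ 2 =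
        2 * (‖c‖ ^ 2 + ρ ^ 2) := by
      have := parallelogram_law_with_norm ℝ c (ρ • (ω : V3))
      rw [norm_smul, norm_eq_of_mem_sphere ω, mul_one, Real.norm_eq_abs, sq_abs] at this
      linarith
    rw [h, h]
  · refine hinv (fun _ I => I) (hint _ (.inr (.inr (.inr rfl)))) fun c ρ E r s ω σ => ?_
    ring
end
end

section
/- Let θ ∈ [0,1] and let f : ℝ³ × (0,∞) → (0,∞) be measurable such that all the integrals below converge absolutely. Then the entropy-dissipation functional W_θ[f] = ∫_{ℝ³×[0,∞)} [θ Q_s(f,f)(ξ,I) + (1−θ) Q_r(f,f)(ξ,I)] · log( I^{1−δ/2} f(ξ,I) ) dξ dI satisfies W_θ[f] ≤ 0. -/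
noncomputable section

open MeasureTheory Real
open scoped BigOperators RealInnerProductSpace

open scoped ENNReal NNReal

theorem lintegral_eq_lintegral_lintegral_smul_sphere (h : V3 → ℝ≥0∞) (hh : Measurable h) :
    ∫⁻ g, h g = ∫⁻ ρ in Set.Ioi (0 : ℝ), ∫⁻ σ : Sph,
      ENNReal.ofReal (ρ ^ 2) * h (ρ • (σ : V3)) ∂sphMeasure := by
  have hdim : Module.finrank ℝ V3 - 1 = 2 := by simp
  calc ∫⁻ g, h g
      = ∫⁻ x : ({0}ᶜ : Set V3), h x ∂((volume : Measure V3).comap (↑)) := by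
        rw [lintegral_subtype_comap (measurableSet_singleton _).compl h,
          restrict_compl_singleton]
    _ = ∫⁻ x : Sph × Set.Ioi (0 : ℝ), h ((x.2 : ℝ) • (x.1 : V3))
          ∂(sphMeasure.prod (Measure.volumeIoiPow 2)) := by
        rw [← hdim, sphMeasure,
          ← ((volume : Measure V3).measurePreserving_homeomorphUnitSphereProd).lintegral_comp_emb
            (Homeomorph.measurableEmbedding _)]
        refine lintegral_congr fun x => ?_
        congr 1
        have hx : ‖(x : V3)‖ ≠ 0 := norm_ne_zero_iff.2 x.2
        simp [smul_smul, mul_inv_cancel₀ hx]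
    _ = ∫⁻ ρ : Set.Ioi (0 : ℝ), ∫⁻ σ : Sph, h ((ρ : ℝ) • (σ : V3)) ∂sphMeasure
          ∂(Measure.volumeIoiPow 2) := by
        have : IsFiniteMeasure sphMeasure := by unfold sphMeasure; infer_instance
        rw [lintegral_prod_symm' _ (by fun_prop)]
    _ = _ := by
        have : IsFiniteMeasure sphMeasure := by unfold sphMeasure; infer_instance
        have hm : Measurable fun ρ : ℝ => ∫⁻ σ : Sph, h (ρ • (σ : V3)) ∂sphMeasure :=
          Measurable.lintegral_prod_right' (f := fun p : ℝ × Sph => h (p.1 • (p.2 : V3)))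
            (by fun_prop)
        rw [Measure.volumeIoiPow, lintegral_withDensity_eq_lintegral_mul _ (by fun_prop)
          (show Measurable fun ρ : Set.Ioi (0 : ℝ) =>
            ∫⁻ σ : Sph, h ((ρ : ℝ) • (σ : V3)) ∂sphMeasure from hm.comp measurable_subtype_coe)]
        simp only [Pi.mul_apply]
        rw [lintegral_subtype_comap measurableSet_Ioi fun ρ : ℝ =>
          ENNReal.ofReal (ρ ^ 2) * ∫⁻ σ : Sph, h (ρ • (σ : V3)) ∂sphMeasure]
        refine lintegral_congr fun ρ => ?_
        rw [lintegral_const_mul _ (by fun_prop)]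

theorem setLIntegral_Ioi_sq_mul (m : ℝ) (hm : 0 < m) (k : ℝ → ℝ≥0∞) :
    ∫⁻ ρ in Set.Ioi (0 : ℝ), ENNReal.ofReal (ρ ^ 2) * k ρ =
      ∫⁻ e in Set.Ioi (0 : ℝ), ENNReal.ofReal (4 / m * √(e / m)) * k (2 * √(e / m)) := by
  have himg : (fun e : ℝ => 2 * √(e / m)) '' Set.Ioi 0 = Set.Ioi 0 := by
    ext x
    simp only [Set.mem_image, Set.mem_Ioi]
    constructor
    · rintro ⟨e, he, rfl⟩
      positivity
    · intro hx
      refine ⟨m * (x / 2) ^ 2, by positivity, ?_⟩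
      rw [mul_div_cancel_left₀ _ hm.ne', Real.sqrt_sq (by positivity)]
      ring
  have hinj : Set.InjOn (fun e : ℝ => 2 * √(e / m)) (Set.Ioi 0) := by
    intro a ha b hb hab
    simp only [Set.mem_Ioi] at ha hb
    have h1 : √(a / m) = √(b / m) := by simpa using hab
    rw [Real.sqrt_inj (by positivity) (by positivity)] at h1
    field_simp at h1
    exact h1
  have hder : ∀ e ∈ Set.Ioi (0 : ℝ), HasDerivWithinAt (fun e : ℝ => 2 * √(e / m))
      (2 * (1 / m / (2 * √(e / m)))) (Set.Ioi 0) e := by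
    intro e he
    simp only [Set.mem_Ioi] at he
    exact ((((hasDerivAt_id e).div_const m).sqrt (div_pos he hm).ne').const_mul
      2).hasDerivWithinAt
  conv_lhs => rw [← himg]
  rw [lintegral_image_eq_lintegral_abs_deriv_mul measurableSet_Ioi hder hinj]
  refine setLIntegral_congr_fun measurableSet_Ioi fun e he => ?_
  simp only [Set.mem_Ioi] at he
  have hs : 0 < √(e / m) := by positivity
  rw [← mul_assoc, ← ENNReal.ofReal_mul (abs_nonneg _), abs_of_pos (by positivity)]
  congr 2
  field_simp
  ring

theorem setLIntegral_setLIntegral_Ioi_eq (h : ℝ → ℝ → ℝ≥0∞)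
    (hh : Measurable (Function.uncurry h)) :
    ∫⁻ x in Set.Ioi (0 : ℝ), ∫⁻ y in Set.Ioi (0 : ℝ), h x y =
      ∫⁻ t in Set.Ioi (0 : ℝ), ∫⁻ r in Set.Icc (0 : ℝ) 1,
        ENNReal.ofReal t * h (r * t) ((1 - r) * t) := by
  have hh' : Measurable fun p : ℝ × ℝ => h p.1 p.2 := hh
  let H : ℝ → ℝ → ℝ≥0∞ := fun x y =>
    (Set.Ioi (0 : ℝ) ×ˢ Set.Ioi (0 : ℝ)).indicator (fun p => h p.1 p.2) (x, y)
  have hH : Measurable fun p : ℝ × ℝ => H p.1 p.2 :=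
    hh'.indicator (measurableSet_Ioi.prod measurableSet_Ioi)
  calc ∫⁻ x in Set.Ioi (0 : ℝ), ∫⁻ y in Set.Ioi (0 : ℝ), h x y
      = ∫⁻ x, ∫⁻ y, H x y := by
        rw [← lintegral_indicator measurableSet_Ioi]
        refine lintegral_congr fun x => ?_
        by_cases hx : x ∈ Set.Ioi (0 : ℝ)
        · rw [Set.indicator_of_mem hx, ← lintegral_indicator measurableSet_Ioi]
          refine lintegral_congr fun y => ?_
          by_cases hy : y ∈ Set.Ioi (0 : ℝ) <;> simp_all [H, Set.indicator]
        · rw [Set.indicator_of_notMem hx]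
          have hx0 : ∀ y, H x y = 0 := fun y =>
            Set.indicator_of_notMem (fun hxy => hx hxy.1) _
          simp [hx0]
    _ = ∫⁻ x, ∫⁻ t, H x (t - x) := by
        refine lintegral_congr fun x => ?_
        rw [lintegral_sub_right_eq_self (fun y => H x y) x]
    _ = ∫⁻ t, ∫⁻ x, H x (t - x) := by
        refine lintegral_lintegral_swap ?_
        exact (hH.comp (by fun_prop : Measurable fun p : ℝ × ℝ => (p.1, p.2 - p.1))).aemeasurable
    _ = ∫⁻ t in Set.Ioi (0 : ℝ), ∫⁻ x, H x (t - x) := by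
        rw [← lintegral_indicator measurableSet_Ioi]
        refine lintegral_congr fun t => ?_
        by_cases ht : t ∈ Set.Ioi (0 : ℝ)
        · rw [Set.indicator_of_mem ht]
        · rw [Set.indicator_of_notMem ht, lintegral_eq_zero_iff (by fun_prop)]
          filter_upwards with x
          refine Set.indicator_of_notMem ?_ _
          simp only [Set.mem_prod, Set.mem_Ioi] at ht ⊢
          rintro ⟨h1, h2⟩
          linarith
    _ = ∫⁻ t in Set.Ioi (0 : ℝ), ∫⁻ r, ENNReal.ofReal t * H (r * t) ((1 - r) * t) := by
        refine setLIntegral_congr_fun measurableSet_Ioi fun t ht => ?_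
        simp only [Set.mem_Ioi] at ht
        have hm1 : Measurable fun x => H x (t - x) := by fun_prop
        have hm2 : Measurable fun r => H (r * t) ((1 - r) * t) := by fun_prop
        change ∫⁻ x, H x (t - x) = ∫⁻ r, ENNReal.ofReal t * H (r * t) ((1 - r) * t)
        rw [lintegral_const_mul _ hm2]
        conv_lhs => rw [← Real.smul_map_volume_mul_right ht.ne', lintegral_smul_measure,
          lintegral_map hm1 (by fun_prop), abs_of_pos ht]
        simp only [smul_eq_mul]
        congr 1
        refine lintegral_congr fun r => ?_
        congr 1
        ring
    _ = _ := by
        refine setLIntegral_congr_fun measurableSet_Ioi fun t ht => ?_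
        simp only [Set.mem_Ioi] at ht
        rw [← setLIntegral_congr Ioo_ae_eq_Icc, ← lintegral_indicator measurableSet_Ioo]
        refine lintegral_congr fun r => ?_
        by_cases hr : r ∈ Set.Ioo (0 : ℝ) 1
        · rw [Set.indicator_of_mem hr]
          congr 1
          refine Set.indicator_of_mem (s := Set.Ioi (0 : ℝ) ×ˢ Set.Ioi (0 : ℝ)) ?_ _
          exact ⟨mul_pos hr.1 ht, mul_pos (by linarith [hr.2]) ht⟩
        · rw [Set.indicator_of_notMem hr]
          have : H (r * t) ((1 - r) * t) = 0 := by
            refine Set.indicator_of_notMem ?_ _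
            rintro ⟨h1, h2⟩
            simp only [Set.mem_Ioi] at h1 h2
            exact hr ⟨pos_of_mul_pos_left h1 ht.le, by
              linarith [pos_of_mul_pos_left h2 ht.le]⟩
          rw [this, mul_zero]

theorem lintegral_lintegral_eq_midpoint (h : V3 → V3 → ℝ≥0∞)
    (hh : Measurable (Function.uncurry h)) :
    ∫⁻ ξ, ∫⁻ ξs, h ξ ξs =
      ∫⁻ V : V3, ∫⁻ g : V3, h (V + (1 / 2 : ℝ) • g) (V - (1 / 2 : ℝ) • g) := by
  have hh' : Measurable fun p : V3 × V3 => h p.1 p.2 := hh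
  calc ∫⁻ ξ, ∫⁻ ξs, h ξ ξs = ∫⁻ ξ : V3, ∫⁻ g : V3, h ξ (ξ - g) := by
        refine lintegral_congr fun ξ => ?_
        rw [lintegral_sub_left_eq_self (fun y => h ξ y) ξ]
    _ = ∫⁻ g : V3, ∫⁻ ξ : V3, h ξ (ξ - g) := by
        refine lintegral_lintegral_swap ?_
        exact (hh'.comp
          (by fun_prop : Measurable fun p : V3 × V3 => (p.1, p.1 - p.2))).aemeasurable
    _ = ∫⁻ g : V3, ∫⁻ V : V3, h (V + (1 / 2 : ℝ) • g) (V - (1 / 2 : ℝ) • g) := by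
        refine lintegral_congr fun g => ?_
        rw [← lintegral_add_right_eq_self (fun ξ => h ξ (ξ - g)) ((1 / 2 : ℝ) • g)]
        refine lintegral_congr fun V => ?_
        congr 1
        module
    _ = _ := by
        refine lintegral_lintegral_swap ?_
        exact (hh'.comp (by fun_prop : Measurable fun p : V3 × V3 =>
          (p.2 + (1 / 2 : ℝ) • p.1, p.2 - (1 / 2 : ℝ) • p.1))).aemeasurable
instance inst_s2 : IsFiniteMeasure sphMeasure := by
  unfold sphMeasure
  infer_instance

instance : SigmaFinite phaseMeasure := by
  unfold phaseMeasure
  infer_instance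

namespace MeasureTheory.MeasurePreserving

variable {X Y : Type*} [MeasurableSpace X] [MeasurableSpace Y] {μ : Measure X} {ν : Measure Y}
  {s : X → Y}

theorem integral_comp_of_aestronglyMeasurable (hs : MeasurePreserving s μ ν) {F : Y → ℝ}
    (hF : AEStronglyMeasurable F ν) : ∫ x, F (s x) ∂μ = ∫ y, F y ∂ν := by
  rw [← hs.map_eq] at hF ⊢
  exact (integral_map hs.aemeasurable hF).symm

theorem integrable_comp_fun (hs : MeasurePreserving s μ ν) {F : Y → ℝ} (hF : Integrable F ν) :
    Integrable (fun x => F (s x)) μ :=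
  hs.integrable_comp_of_integrable hF

theorem integral_nonpos_of_add_comp_nonpos {s : X → X} (hs : MeasurePreserving s μ μ) {F : X → ℝ}
    (hF : Integrable F μ) (h : ∀ᵐ x ∂μ, F x + F (s x) ≤ 0) : ∫ x, F x ∂μ ≤ 0 := by
  have h1 := integral_nonpos_of_ae h
  have h2 : ∫ x, F x + F (s x) ∂μ = ∫ x, F x ∂μ + ∫ x, F (s x) ∂μ :=
    integral_add hF (hs.integrable_comp_fun hF)
  rw [hs.integral_comp_of_aestronglyMeasurable hF.1] at h2
  linarith

end MeasureTheory.MeasurePreserving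

theorem integral_nonpos_of_parametrization {Y Ω Z : Type*} [MeasurableSpace Y] [MeasurableSpace Ω]
    [MeasurableSpace Z] {τ : Measure Y} [SFinite τ] {lam : Measure Ω} [SFinite lam]
    {μ : Measure Z} [SFinite μ] {κ : Y × Ω → ℝ≥0} (hκ : Measurable κ) {Φ : Y × Ω → Z}
    (hΦ : MeasurePreserving Φ ((τ.prod lam).withDensity fun x => κ x) μ)
    {F : Z × Ω → ℝ} (hF : Integrable F (μ.prod lam))
    (hsym : ∀ᵐ x ∂(τ.prod (lam.prod lam)),
      (κ (x.1, x.2.1) : ℝ) * F (Φ (x.1, x.2.1), x.2.2) +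
        (κ (x.1, x.2.2) : ℝ) * F (Φ (x.1, x.2.2), x.2.1) ≤ 0) :
    ∫ z, F z ∂(μ.prod lam) ≤ 0 := by
  have h1 : MeasurePreserving (Prod.map Φ id)
      (((τ.prod lam).prod lam).withDensity fun x => (κ x.1 : ℝ≥0∞)) (μ.prod lam) := by
    have h := hΦ.prod (MeasurePreserving.id lam)
    rwa [prod_withDensity_left (by fun_prop)] at h
  have hκ1 : Measurable fun x : (Y × Ω) × Ω => κ x.1 := by fun_prop
  have h2 := h1.integrable_comp_fun hF
  rw [integrable_withDensity_iff_integrable_coe_smul hκ1] at h2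
  rw [← h1.integral_comp_of_aestronglyMeasurable hF.1,
    integral_withDensity_eq_integral_smul hκ1]
  have h3 := (measurePreserving_prodAssoc τ lam lam).symm MeasurableEquiv.prodAssoc
  have h4 : MeasurePreserving (Prod.map id Prod.swap) (τ.prod (lam.prod lam))
      (τ.prod (lam.prod lam)) :=
    (MeasurePreserving.id τ).prod Measure.measurePreserving_swap
  have h5 := h3.integral_comp_of_aestronglyMeasurable h2.1
  simp only [NNReal.smul_def]
  rw [← h5]
  refine h4.integral_nonpos_of_add_comp_nonpos (h3.integrable_comp_fun h2) ?_
  filter_upwards [hsym] with x hx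
  exact hx

theorem measurePreserving_prod_reassoc {A B Q Ω : Type*} [MeasurableSpace A] [MeasurableSpace B]
    [MeasurableSpace Q] [MeasurableSpace Ω] (a : Measure A) (b : Measure B) (q : Measure Q)
    (w : Measure Ω) [SFinite a] [SFinite b] [SFinite q] [SFinite w] :
    MeasurePreserving (fun x : ((A × B) × Q) × Ω => (x.1.1.1, x.1.1.2, x.1.2, x.2))
      (((a.prod b).prod q).prod w) (a.prod (b.prod (q.prod w))) :=
  (measurePreserving_prodAssoc a b (q.prod w)).comp (measurePreserving_prodAssoc (a.prod b) q w)

/-- Flattening of the phase-space pairs into the variable order of the moment integrals. -/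
theorem measurePreserving_flatten_s2 {Ω : Type*} [MeasurableSpace Ω] (w : Measure Ω) [SFinite w] :
    MeasurePreserving
      (fun x : ((V3 × ℝ) × (V3 × ℝ)) × Ω =>
        (x.1.1.1, x.1.1.2, x.1.2.1, x.1.2.2, x.2))
      ((phaseMeasure.prod phaseMeasure).prod w)
      ((volume : Measure V3).prod (((volume : Measure ℝ).restrict (Set.Ici 0)).prod
        ((volume : Measure V3).prod (((volume : Measure ℝ).restrict (Set.Ici 0)).prod w)))) := by
  have h1 := measurePreserving_prod_reassoc (volume : Measure V3)
    ((volume : Measure ℝ).restrict (Set.Ici 0)) phaseMeasure w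
  have h2 := measurePreserving_prodAssoc (volume : Measure V3)
    ((volume : Measure ℝ).restrict (Set.Ici 0)) w
  exact ((MeasurePreserving.id (volume : Measure V3)).prod
    ((MeasurePreserving.id ((volume : Measure ℝ).restrict (Set.Ici 0))).prod h2)).comp h1

/-- The measure `dσ dr` on the parameters of resonant collisions. -/
def resAngleMeasure : Measure (Sph × ℝ) :=
  sphMeasure.prod ((volume : Measure ℝ).restrict (Set.Icc 0 1))

/-- The measure `dσ dr dR` on the parameters of standard collisions. -/
def stdAngleMeasure : Measure (Sph × ℝ × ℝ) :=
  sphMeasure.prod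
    (((volume : Measure ℝ).restrict (Set.Icc 0 1)).prod ((volume : Measure ℝ).restrict (Set.Icc 0 1)))

instance : SigmaFinite resAngleMeasure := by
  unfold resAngleMeasure
  infer_instance

instance : SigmaFinite stdAngleMeasure := by
  unfold stdAngleMeasure
  infer_instance

/-- The measure on the quantities `(V, e, s)` conserved by resonant collisions: mean velocity,
relative kinetic energy and total internal energy. -/
def resConservedMeasure : Measure (V3 × ℝ × ℝ) :=
  (volume : Measure V3).prod (((volume : Measure ℝ).restrict (Set.Ioi 0)).prod
    ((volume : Measure ℝ).restrict (Set.Ioi 0)))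

/-- The measure on the quantities `(V, E)` conserved by standard collisions: mean velocity and
total energy. -/
def stdConservedMeasure : Measure (V3 × ℝ) :=
  (volume : Measure V3).prod ((volume : Measure ℝ).restrict (Set.Ioi 0))

instance : SigmaFinite resConservedMeasure := by
  unfold resConservedMeasure
  infer_instance

instance : SigmaFinite stdConservedMeasure := by
  unfold stdConservedMeasure
  infer_instance

/-- The pair of particles with conserved quantities `(V, e, s)` and parameters `(σ, r)`. -/
def resParam (m : ℝ) (x : (V3 × ℝ × ℝ) × (Sph × ℝ)) : (V3 × ℝ) × (V3 × ℝ) :=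
  ((x.1.1 + √(x.1.2.1 / m) • (x.2.1 : V3), x.2.2 * x.1.2.2),
    (x.1.1 - √(x.1.2.1 / m) • (x.2.1 : V3), (1 - x.2.2) * x.1.2.2))

/-- The Jacobian of `resParam`. -/
def resJacobian (m : ℝ) (x : (V3 × ℝ × ℝ) × (Sph × ℝ)) : ℝ≥0 :=
  Real.toNNReal (4 / m * √(x.1.2.1 / m) * x.1.2.2)

/-- The pair of particles with conserved quantities `(V, E)` and parameters `(σ, r, R)`. -/
def stdParam (m : ℝ) (x : (V3 × ℝ) × (Sph × ℝ × ℝ)) : (V3 × ℝ) × (V3 × ℝ) :=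
  resParam m ((x.1.1, x.2.2.2 * x.1.2, (1 - x.2.2.2) * x.1.2), (x.2.1, x.2.2.1))

/-- The Jacobian of `stdParam`. -/
def stdJacobian (m : ℝ) (x : (V3 × ℝ) × (Sph × ℝ × ℝ)) : ℝ≥0 :=
  Real.toNNReal x.1.2 *
    resJacobian m ((x.1.1, x.2.2.2 * x.1.2, (1 - x.2.2.2) * x.1.2), (x.2.1, x.2.2.1))

@[fun_prop]
theorem measurable_resParam (m : ℝ) : Measurable (resParam m) := by
  unfold resParam
  fun_prop

@[fun_prop]
theorem measurable_resJacobian (m : ℝ) : Measurable (resJacobian m) := by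
  unfold resJacobian
  fun_prop

@[fun_prop]
theorem measurable_stdParam (m : ℝ) : Measurable (stdParam m) := by
  unfold stdParam
  fun_prop

@[fun_prop]
theorem measurable_stdJacobian (m : ℝ) : Measurable (stdJacobian m) := by
  unfold stdJacobian
  fun_prop

theorem lintegral_phaseMeasure_prod (h : (V3 × ℝ) × (V3 × ℝ) → ℝ≥0∞) (hh : Measurable h) :
    ∫⁻ z, h z ∂(phaseMeasure.prod phaseMeasure) =
      ∫⁻ ξ : V3, ∫⁻ ξs : V3, ∫⁻ I in Set.Ioi (0 : ℝ), ∫⁻ Is in Set.Ioi (0 : ℝ),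
        h ((ξ, I), (ξs, Is)) := by
  have hp : phaseMeasure =
      (volume : Measure V3).prod ((volume : Measure ℝ).restrict (Set.Ioi 0)) := by
    rw [phaseMeasure, restrict_Ioi_eq_restrict_Ici]
  rw [hp, lintegral_prod _ (by fun_prop), lintegral_prod _ (by fun_prop)]
  refine lintegral_congr fun ξ => ?_
  rw [lintegral_lintegral_swap (by fun_prop), lintegral_prod _ (by fun_prop)]
  refine lintegral_congr fun ξs => ?_
  rw [lintegral_lintegral_swap (by fun_prop)]

theorem measurePreserving_resParam (m : ℝ) (hm : 0 < m) :
    MeasurePreserving (resParam m)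
      ((resConservedMeasure.prod resAngleMeasure).withDensity fun x => resJacobian m x)
      (phaseMeasure.prod phaseMeasure) := by
  refine ⟨measurable_resParam m, Measure.ext_of_lintegral _ fun h hh => Eq.symm ?_⟩
  rw [lintegral_map hh (by fun_prop), lintegral_withDensity_eq_lintegral_mul _ (by fun_prop)
    (by fun_prop), lintegral_phaseMeasure_prod h hh]
  have hK : ∀ ξ ξs : V3, ∫⁻ I in Set.Ioi (0 : ℝ), ∫⁻ Is in Set.Ioi (0 : ℝ), h ((ξ, I), (ξs, Is)) =
      ∫⁻ s in Set.Ioi (0 : ℝ), ∫⁻ r in Set.Icc (0 : ℝ) 1,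
        ENNReal.ofReal s * h ((ξ, r * s), (ξs, (1 - r) * s)) := fun ξ ξs =>
    setLIntegral_setLIntegral_Ioi_eq (fun I Is => h ((ξ, I), (ξs, Is)))
      (by unfold Function.uncurry; fun_prop)
  simp only [hK]
  rw [lintegral_lintegral_eq_midpoint _ (by unfold Function.uncurry; fun_prop),
    resConservedMeasure, resAngleMeasure, lintegral_prod _ (by fun_prop),
    lintegral_prod _ (by fun_prop)]
  refine lintegral_congr fun V => ?_
  rw [lintegral_eq_lintegral_lintegral_smul_sphere _ (by fun_prop)]
  have hc : ∀ ρ : ℝ, ∀ k : V3 → ℝ≥0∞, Measurable k →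
      ∫⁻ σ : Sph, ENNReal.ofReal (ρ ^ 2) * k (ρ • (σ : V3)) ∂sphMeasure =
        ENNReal.ofReal (ρ ^ 2) * ∫⁻ σ : Sph, k (ρ • (σ : V3)) ∂sphMeasure := fun ρ k hk =>
    lintegral_const_mul _ (by fun_prop)
  simp_rw [fun ρ => hc ρ (fun g => ∫⁻ s in Set.Ioi (0 : ℝ), ∫⁻ r in Set.Icc (0 : ℝ) 1,
    ENNReal.ofReal s * h ((V + (1 / 2 : ℝ) • g, r * s), (V - (1 / 2 : ℝ) • g, (1 - r) * s)))
    (by fun_prop)]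
  rw [setLIntegral_Ioi_sq_mul m hm (fun ρ => ∫⁻ σ : Sph, (∫⁻ s in Set.Ioi (0 : ℝ),
    ∫⁻ r in Set.Icc (0 : ℝ) 1, ENNReal.ofReal s * h ((V + (1 / 2 : ℝ) • ρ • (σ : V3), r * s),
      (V - (1 / 2 : ℝ) • ρ • (σ : V3), (1 - r) * s))) ∂sphMeasure), lintegral_prod _ (by fun_prop)]
  refine lintegral_congr fun e => ?_
  rw [lintegral_lintegral_swap (by fun_prop), ← lintegral_const_mul _ (by fun_prop)]
  refine lintegral_congr fun s => ?_
  rw [← lintegral_const_mul _ (by fun_prop), lintegral_prod _ (by fun_prop)]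
  refine lintegral_congr fun σ => ?_
  rw [← lintegral_const_mul _ (by fun_prop)]
  refine lintegral_congr fun r => ?_
  have h2 : (1 / 2 : ℝ) • (2 * √(e / m)) • (σ : V3) = √(e / m) • (σ : V3) := by
    rw [smul_smul]
    congr 1
    ring
  rw [h2, ← mul_assoc, ← ENNReal.ofReal_mul (by positivity)]
  rfl

theorem measurePreserving_stdParam (m : ℝ) (hm : 0 < m) :
    MeasurePreserving (stdParam m)
      ((stdConservedMeasure.prod stdAngleMeasure).withDensity fun x => stdJacobian m x)
      (phaseMeasure.prod phaseMeasure) := by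
  refine ⟨measurable_stdParam m, Measure.ext_of_lintegral _ fun h hh => Eq.symm ?_⟩
  have hres := measurePreserving_resParam m hm
  rw [lintegral_map hh (by fun_prop), lintegral_withDensity_eq_lintegral_mul _ (by fun_prop)
    (by fun_prop), ← hres.lintegral_comp hh, lintegral_withDensity_eq_lintegral_mul _
    (by fun_prop) (by fun_prop), resConservedMeasure, stdConservedMeasure,
    lintegral_prod _ (by fun_prop), lintegral_prod _ (by fun_prop),
    lintegral_prod _ (by fun_prop), lintegral_prod _ (by fun_prop)]
  refine lintegral_congr fun V => ?_
  rw [lintegral_prod _ (by fun_prop)]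
  simp only [Pi.mul_apply]
  rw [setLIntegral_setLIntegral_Ioi_eq (fun e s => ∫⁻ ω, (resJacobian m ((V, e, s), ω) : ℝ≥0∞) *
    h (resParam m ((V, e, s), ω)) ∂resAngleMeasure) (by unfold Function.uncurry; fun_prop)]
  refine lintegral_congr fun E => ?_
  simp_rw [resAngleMeasure, stdAngleMeasure]
  rw [lintegral_prod _ (by fun_prop)]
  have hc : ∀ R : ℝ, ENNReal.ofReal E * ∫⁻ ω, (resJacobian m ((V, R * E, (1 - R) * E), ω) : ℝ≥0∞) *
        h (resParam m ((V, R * E, (1 - R) * E), ω))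
          ∂(sphMeasure.prod ((volume : Measure ℝ).restrict (Set.Icc 0 1))) =
      ∫⁻ σ : Sph, (∫⁻ r in Set.Icc (0 : ℝ) 1, ENNReal.ofReal E *
        ((resJacobian m ((V, R * E, (1 - R) * E), (σ, r)) : ℝ≥0∞) *
          h (resParam m ((V, R * E, (1 - R) * E), (σ, r))))) ∂sphMeasure := fun R => by
    rw [← lintegral_const_mul _ (by fun_prop), lintegral_prod _ (by fun_prop)]
  simp_rw [hc]
  rw [lintegral_lintegral_swap (by fun_prop)]
  refine lintegral_congr fun σ => ?_
  rw [lintegral_lintegral_swap (by fun_prop), lintegral_prod _ (by fun_prop)]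
  refine lintegral_congr fun r => lintegral_congr fun R => ?_
  simp only [stdJacobian, stdParam, ENNReal.coe_mul, mul_assoc]
  rfl
theorem integrable_and_integral_collision_mul {Ω : Type*} [MeasurableSpace Ω] {w : Measure Ω} [SigmaFinite w]
    {G : ((V3 × ℝ) × (V3 × ℝ)) × Ω → ℝ} {L : V3 × ℝ → ℝ} {J : V3 × ℝ → V3 × ℝ → ℝ}
    (hG : Integrable (fun x => G x * L x.1.1) ((phaseMeasure.prod phaseMeasure).prod w))
    (hJ : ∀ p q, Integrable (fun ω => G ((p, q), ω)) w → J p q = ∫ ω, G ((p, q), ω) ∂w) :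
    Integrable (fun p => (∫ Is in Set.Ici (0 : ℝ), ∫ ξs : V3, J p (ξs, Is)) * L p) phaseMeasure ∧
      ∫ p, (∫ Is in Set.Ici (0 : ℝ), ∫ ξs : V3, J p (ξs, Is)) * L p ∂phaseMeasure =
        ∫ x, G x * L x.1.1 ∂((phaseMeasure.prod phaseMeasure).prod w) := by
  have hassoc := (measurePreserving_prodAssoc phaseMeasure phaseMeasure w).symm
    MeasurableEquiv.prodAssoc
  have hG' : Integrable (fun x : (V3 × ℝ) × (V3 × ℝ) × Ω => G ((x.1, x.2.1), x.2.2) * L x.1)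
      (phaseMeasure.prod (phaseMeasure.prod w)) := hassoc.integrable_comp_fun hG
  have hae : (fun p => ∫ x : (V3 × ℝ) × Ω, G ((p, x.1), x.2) * L p ∂(phaseMeasure.prod w))
      =ᵐ[phaseMeasure]
      fun p => (∫ Is in Set.Ici (0 : ℝ), ∫ ξs : V3, J p (ξs, Is)) * L p := by
    filter_upwards [hG'.prod_right_ae] with p hp
    rw [integral_mul_const]
    rcases eq_or_ne (L p) 0 with h0 | h0
    · simp [h0]
    congr 1
    have hp' : Integrable (fun x : (V3 × ℝ) × Ω => G ((p, x.1), x.2)) (phaseMeasure.prod w) := by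
      simpa [mul_assoc, h0] using hp.mul_const (L p)⁻¹
    have hJp : (fun q => ∫ ω, G ((p, q), ω) ∂w) =ᵐ[phaseMeasure] J p := by
      filter_upwards [hp'.prod_right_ae] with q hq
      exact (hJ p q hq).symm
    rw [integral_prod _ hp', integral_congr_ae hJp]
    exact integral_prod_symm (J p) (hp'.integral_prod_left.congr hJp)
  refine ⟨hG'.integral_prod_left.congr hae, ?_⟩
  rw [← integral_congr_ae hae, ← integral_prod _ hG',
    ← hassoc.integral_comp_of_aestronglyMeasurable hG.1]
  rfl

theorem integral_mul_nonpos_of_symm {Ω : Type*} [MeasurableSpace Ω] {w : Measure Ω} [SigmaFinite w]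
    {G : ((V3 × ℝ) × (V3 × ℝ)) × Ω → ℝ} {L : V3 × ℝ → ℝ}
    (hG : Integrable (fun x => G x * L x.1.1) ((phaseMeasure.prod phaseMeasure).prod w))
    (hsymm : ∀ p q ω, G ((q, p), ω) = G ((p, q), ω))
    {Y : Type*} [MeasurableSpace Y] {τ : Measure Y} [SFinite τ] {κ : Y × Ω → ℝ≥0}
    (hκ : Measurable κ) {Φ : Y × Ω → (V3 × ℝ) × (V3 × ℝ)}
    (hΦ : MeasurePreserving Φ ((τ.prod w).withDensity fun x => κ x)
      (phaseMeasure.prod phaseMeasure))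
    {S : Y → Ω → Ω → ℝ} {d : (V3 × ℝ) × (V3 × ℝ) → ℝ} {P : Y → Prop} {A : Ω → Prop}
    (hP : ∀ᵐ y ∂τ, P y) (hA : ∀ᵐ ω ∂w, A ω)
    (hGd : ∀ y ω ω', P y → A ω → A ω' →
      κ (y, ω) * G (Φ (y, ω), ω') = S y ω ω' * (d (Φ (y, ω')) - d (Φ (y, ω))))
    (hS : ∀ y ω ω', S y ω ω' = S y ω' ω)
    (hS0 : ∀ y ω ω', P y → A ω → A ω' → 0 ≤ S y ω ω')
    (hd : ∀ y ω, P y → A ω → 0 < d (Φ (y, ω)))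
    (hL : ∀ y ω, P y → A ω → L (Φ (y, ω)).1 + L (Φ (y, ω)).2 = Real.log (d (Φ (y, ω)))) :
    ∫ x, G x * L x.1.1 ∂((phaseMeasure.prod phaseMeasure).prod w) ≤ 0 := by
  have hswap : MeasurePreserving (Prod.map Prod.swap id)
      ((phaseMeasure.prod phaseMeasure).prod w) ((phaseMeasure.prod phaseMeasure).prod w) :=
    Measure.measurePreserving_swap.prod (MeasurePreserving.id w)
  have heq : ∀ x : ((V3 × ℝ) × (V3 × ℝ)) × Ω,
      (fun x => G x * L x.1.1) (Prod.map Prod.swap id x) = G x * L x.1.2 := by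
    rintro ⟨⟨p, q⟩, ω⟩
    simp [hsymm p q ω]
  have hG2 : Integrable (fun x => G x * L x.1.2) ((phaseMeasure.prod phaseMeasure).prod w) := by
    simpa only [heq] using hswap.integrable_comp_fun hG
  have hint2 : ∫ x, G x * L x.1.2 ∂((phaseMeasure.prod phaseMeasure).prod w) =
      ∫ x, G x * L x.1.1 ∂((phaseMeasure.prod phaseMeasure).prod w) := by
    simpa only [heq] using hswap.integral_comp_of_aestronglyMeasurable hG.1
  have key : ∫ x, (G x * L x.1.1 + G x * L x.1.2) ∂((phaseMeasure.prod phaseMeasure).prod w) ≤ 0 := by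
    refine integral_nonpos_of_parametrization hκ hΦ (hG.add hG2) ?_
    filter_upwards [Measure.quasiMeasurePreserving_fst.ae hP,
      Measure.quasiMeasurePreserving_snd.ae (Measure.quasiMeasurePreserving_fst.ae hA),
      Measure.quasiMeasurePreserving_snd.ae (Measure.quasiMeasurePreserving_snd.ae hA)] with x h1 h2 h3
    obtain ⟨y, ω, ω'⟩ := x
    have e1 := hGd y ω ω' h1 h2 h3
    have e2 := hGd y ω' ω h1 h3 h2
    have l1 := hL y ω h1 h2
    have l2 := hL y ω' h1 h3
    simp only [← mul_add, l1, l2, ← mul_assoc, e1, e2, hS y ω' ω]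
    have hS1 := hS0 y ω ω' h1 h2 h3
    have hd1 := hd y ω h1 h2
    have hd2 := hd y ω' h1 h3
    have hmono : 0 ≤ (d (Φ (y, ω')) - d (Φ (y, ω))) *
        (Real.log (d (Φ (y, ω'))) - Real.log (d (Φ (y, ω)))) := by
      rcases le_total (d (Φ (y, ω))) (d (Φ (y, ω'))) with h | h
      · exact mul_nonneg (by linarith) (by linarith [Real.log_le_log hd1 h])
      · exact mul_nonneg_of_nonpos_of_nonpos (by linarith) (by linarith [Real.log_le_log hd2 h])
    linarith [mul_nonneg hS1 hmono]
  rw [integral_add hG hG2, hint2] at key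
  linarith

/-- The product of the two distribution functions, normalized by the degeneracy of the internal
energies. -/
def pairDensity (δ : ℝ) (f : V3 → ℝ → ℝ) (z : (V3 × ℝ) × (V3 × ℝ)) : ℝ :=
  f z.1.1 z.1.2 * f z.2.1 z.2.2 / (z.1.2 * z.2.2) ^ (δ / 2 - 1)

theorem pairDensity_pos {δ : ℝ} {f : V3 → ℝ → ℝ}
    (hfpos : ∀ (ξ : V3) (I : ℝ), 0 < I → 0 < f ξ I) {z : (V3 × ℝ) × (V3 × ℝ)}
    (h1 : 0 < z.1.2) (h2 : 0 < z.2.2) : 0 < pairDensity δ f z := by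
  have := hfpos z.1.1 z.1.2 h1
  have := hfpos z.2.1 z.2.2 h2
  unfold pairDensity
  positivity

theorem log_add_log_eq_log_pairDensity {δ : ℝ} {f : V3 → ℝ → ℝ}
    (hfpos : ∀ (ξ : V3) (I : ℝ), 0 < I → 0 < f ξ I) {z : (V3 × ℝ) × (V3 × ℝ)}
    (h1 : 0 < z.1.2) (h2 : 0 < z.2.2) :
    Real.log (z.1.2 ^ (1 - δ / 2) * f z.1.1 z.1.2) + Real.log (z.2.2 ^ (1 - δ / 2) * f z.2.1 z.2.2) =
      Real.log (pairDensity δ f z) := by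
  have p1 := hfpos z.1.1 z.1.2 h1
  have p2 := hfpos z.2.1 z.2.2 h2
  rw [← Real.log_mul (by positivity) (by positivity), pairDensity]
  congr 1
  rw [show 1 - δ / 2 = -(δ / 2 - 1) by ring, Real.rpow_neg h1.le, Real.rpow_neg h2.le,
    Real.mul_rpow h1.le h2.le]
  field_simp

theorem norm_smul_sphere (c : ℝ) (hc : 0 ≤ c) (σ : Sph) : ‖c • (σ : V3)‖ = c := by
  rw [norm_smul, Real.norm_of_nonneg hc, norm_eq_of_mem_sphere σ, mul_one]

theorem half_smul_add_add_sub (V u : V3) : (1 / 2 : ℝ) • (V + u + (V - u)) = V := by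
  module

theorem norm_add_sub_sub_smul_sphere (V : V3) (c : ℝ) (hc : 0 ≤ c) (σ : Sph) :
    ‖V + c • (σ : V3) - (V - c • (σ : V3))‖ = 2 * c := by
  rw [show V + c • (σ : V3) - (V - c • (σ : V3)) = (2 * c) • (σ : V3) by module,
    norm_smul_sphere _ (by positivity)]

theorem resIntegrand_resParam (m δ α β Cr : ℝ) (f : V3 → ℝ → ℝ) (V : V3) (e s : ℝ)
    (σ σ' : Sph) (r r' : ℝ) :
    resIntegrand δ α β Cr f f (resParam m ((V, e, s), (σ, r))).1.1
        (resParam m ((V, e, s), (σ, r))).1.2 (resParam m ((V, e, s), (σ, r))).2.1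
        (resParam m ((V, e, s), (σ, r))).2.2 σ' r' =
      2 * (pairDensity δ f (resParam m ((V, e, s), (σ', r'))) -
        pairDensity δ f (resParam m ((V, e, s), (σ, r)))) *
      (Cr * s ^ α * (2 * √(e / m)) ^ β * (r * s * ((1 - r) * s)) ^ (δ / 2 - 1) *
        (r' * (1 - r')) ^ (δ / 2 - 1)) := by
  have hs : r * s + (1 - r) * s = s := by ring
  simp only [resIntegrand, resParam, xiPrimeRes, xiStarPrimeRes, IPrimeRes, IStarPrimeRes,
    half_smul_add_add_sub, norm_add_sub_sub_smul_sphere _ _ (Real.sqrt_nonneg (e / m)), hs, pairDensity,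
    mul_div_cancel_left₀ _ (two_ne_zero' ℝ)]
  ring

theorem stdIntegrand_stdParam (m δ α β Cs : ℝ) (hm : 0 < m) (f : V3 → ℝ → ℝ) (V : V3) (E : ℝ)
    (hE : 0 < E) (σ σ' : Sph) (r r' R R' : ℝ) (hR : 0 ≤ R) :
    stdIntegrand m δ α β Cs f f (stdParam m ((V, E), (σ, r, R))).1.1
        (stdParam m ((V, E), (σ, r, R))).1.2 (stdParam m ((V, E), (σ, r, R))).2.1
        (stdParam m ((V, E), (σ, r, R))).2.2 σ' r' R' =
      2 * (pairDensity δ f (stdParam m ((V, E), (σ', r', R'))) -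
        pairDensity δ f (stdParam m ((V, E), (σ, r, R)))) *
      (Cs * ((1 - R) * E) ^ α * (2 * √(R * E / m)) ^ β *
        (r * ((1 - R) * E) * ((1 - r) * ((1 - R) * E))) ^ (δ / 2 - 1) *
        (r' * (1 - r')) ^ (δ / 2 - 1) * (1 - R') ^ (α + δ - 1) * R' ^ ((β + 1) / 2)) := by
  have hs : r * ((1 - R) * E) + (1 - r) * ((1 - R) * E) = (1 - R) * E := by ring
  have hE' : collE m (V + √(R * E / m) • (σ : V3)) (V - √(R * E / m) • (σ : V3))
      (r * ((1 - R) * E)) ((1 - r) * ((1 - R) * E)) = E := by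
    rw [collE, norm_add_sub_sub_smul_sphere _ _ (Real.sqrt_nonneg _), mul_pow,
      Real.sq_sqrt (by positivity)]
    field_simp
    ring
  simp only [stdIntegrand, stdParam, resParam, xiPrimeStd, xiStarPrimeStd, IPrimeStd, IStarPrimeStd,
    half_smul_add_add_sub, norm_add_sub_sub_smul_sphere _ _ (Real.sqrt_nonneg _), hE', hs, pairDensity,
    mul_assoc _ (1 - R') E]
  ring

theorem resJacobian_mul (m δ α β Cr : ℝ) (hm : 0 < m) (V : V3) (e s : ℝ) (he : 0 < e) (hs : 0 < s)
    (σ : Sph) (r r' : ℝ) (hr : r ∈ Set.Ioo (0 : ℝ) 1) :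
    (resJacobian m ((V, e, s), (σ, r)) : ℝ) *
      (Cr * s ^ α * (2 * √(e / m)) ^ β * (r * s * ((1 - r) * s)) ^ (δ / 2 - 1) *
        (r' * (1 - r')) ^ (δ / 2 - 1)) =
    4 / m * √(e / m) * s * (Cr * s ^ α * (2 * √(e / m)) ^ β * (s * s) ^ (δ / 2 - 1)) *
      ((r * (1 - r)) ^ (δ / 2 - 1) * (r' * (1 - r')) ^ (δ / 2 - 1)) := by
  obtain ⟨h0, h1⟩ := hr
  have h1' : 0 < 1 - r := by linarith
  simp only [resJacobian]
  rw [Real.coe_toNNReal _ (by positivity),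
    show r * s * ((1 - r) * s) = (r * (1 - r)) * (s * s) by ring,
    Real.mul_rpow (x := r * (1 - r)) (y := s * s) (by positivity) (by positivity)]
  ring

/-- The dependence on `(r, R)` of the transition kernel of standard collisions. -/
def stdWeight (δ α β : ℝ) (ω : Sph × ℝ × ℝ) : ℝ :=
  (ω.2.1 * (1 - ω.2.1)) ^ (δ / 2 - 1) * (1 - ω.2.2) ^ (α + δ - 1) * ω.2.2 ^ ((β + 1) / 2)

theorem stdJacobian_mul (m δ α β Cs : ℝ) (hm : 0 < m) (V : V3) (E : ℝ) (hE : 0 < E)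
    (σ σ' : Sph) (r r' R R' : ℝ) (hr : r ∈ Set.Ioo (0 : ℝ) 1) (hR : R ∈ Set.Ioo (0 : ℝ) 1) :
    (stdJacobian m ((V, E), (σ, r, R)) : ℝ) *
      (Cs * ((1 - R) * E) ^ α * (2 * √(R * E / m)) ^ β *
        (r * ((1 - R) * E) * ((1 - r) * ((1 - R) * E))) ^ (δ / 2 - 1) *
        (r' * (1 - r')) ^ (δ / 2 - 1) * (1 - R') ^ (α + δ - 1) * R' ^ ((β + 1) / 2)) =
    E * (4 / m) * Cs * E ^ (α + δ - 1) * 2 ^ β * (E / m) ^ ((β + 1) / 2) *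
      (stdWeight δ α β (σ, r, R) * stdWeight δ α β (σ', r', R')) := by
  obtain ⟨h0, h1⟩ := hr
  obtain ⟨h2, h3⟩ := hR
  have h1' : 0 < 1 - r := by linarith
  have h3' : 0 < 1 - R := by linarith
  have hg : √(R * E / m) * (2 * √(R * E / m)) ^ β =
      2 ^ β * (E / m) ^ ((β + 1) / 2) * R ^ ((β + 1) / 2) := by
    have hq : 0 < √(R * E / m) := by positivity
    have : √(R * E / m) * √(R * E / m) ^ β = (E / m) ^ ((β + 1) / 2) * R ^ ((β + 1) / 2) := by
      rw [← Real.mul_rpow (by positivity) (by positivity), show E / m * R = R * E / m by ring,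
        Real.rpow_div_two_eq_sqrt _ (by positivity), Real.rpow_add_one hq.ne', mul_comm]
    rw [Real.mul_rpow (by positivity) hq.le, mul_left_comm, this]
    ring
  have hI : (1 - R) * E * (((1 - R) * E) ^ α *
      (r * ((1 - R) * E) * ((1 - r) * ((1 - R) * E))) ^ (δ / 2 - 1)) =
      (r * (1 - r)) ^ (δ / 2 - 1) * (1 - R) ^ (α + δ - 1) * E ^ (α + δ - 1) := by
    have hx : 0 < (1 - R) * E := by positivity
    rw [show r * ((1 - R) * E) * ((1 - r) * ((1 - R) * E)) =
        (r * (1 - r)) * ((1 - R) * E) ^ (2 : ℝ) by rw [Real.rpow_two]; ring,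
      Real.mul_rpow (x := r * (1 - r)) (y := ((1 - R) * E) ^ (2 : ℝ)) (by positivity)
        (by positivity), ← Real.rpow_mul hx.le, mul_assoc ((r * (1 - r)) ^ (δ / 2 - 1)),
      ← Real.mul_rpow (x := 1 - R) (y := E) (z := α + δ - 1) h3'.le hE.le]
    have : ((1 - R) * E) ^ (α + δ - 1) =
        (1 - R) * E * (((1 - R) * E) ^ α * ((1 - R) * E) ^ (2 * (δ / 2 - 1))) := by
      rw [← Real.rpow_add hx, mul_comm ((1 - R) * E) (_ ^ _), ← Real.rpow_add_one hx.ne']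
      congr 1
      ring
    rw [this]
    ring
  simp only [stdJacobian, resJacobian, NNReal.coe_mul, stdWeight]
  rw [Real.coe_toNNReal _ hE.le, Real.coe_toNNReal _ (by positivity)]
  linear_combination (E * (4 / m) * Cs * (r' * (1 - r')) ^ (δ / 2 - 1) *
    (1 - R') ^ (α + δ - 1) * R' ^ ((β + 1) / 2)) *
    ((1 - R) * E * (((1 - R) * E) ^ α *
      (r * ((1 - R) * E) * ((1 - r) * ((1 - R) * E))) ^ (δ / 2 - 1)) * hg +
    2 ^ β * (E / m) ^ ((β + 1) / 2) * R ^ ((β + 1) / 2) * hI)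

theorem ae_mem_Ioo_of_restrict_Icc :
    ∀ᵐ r ∂((volume : Measure ℝ).restrict (Set.Icc 0 1)), r ∈ Set.Ioo (0 : ℝ) 1 := by
  rw [← restrict_Ioo_eq_restrict_Icc]
  exact ae_restrict_mem measurableSet_Ioo

theorem collE_comm (m : ℝ) (ξ ξs : V3) (I Is : ℝ) : collE m ξs ξ Is I = collE m ξ ξs I Is := by
  rw [collE, collE, norm_sub_rev]
  ring

theorem resIntegrand_comm (δ α β Cr : ℝ) (f : V3 → ℝ → ℝ) (ξ : V3) (I : ℝ) (ξs : V3) (Is : ℝ)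
    (σ : Sph) (r : ℝ) :
    resIntegrand δ α β Cr f f ξs Is ξ I σ r = resIntegrand δ α β Cr f f ξ I ξs Is σ r := by
  simp only [resIntegrand, xiPrimeRes, xiStarPrimeRes, IPrimeRes, IStarPrimeRes,
    norm_sub_rev ξs ξ, add_comm ξs ξ, add_comm Is I, mul_comm Is I,
    add_comm (f ξs Is * f ξ I)]

theorem stdIntegrand_comm (m δ α β Cs : ℝ) (f : V3 → ℝ → ℝ) (ξ : V3) (I : ℝ) (ξs : V3) (Is : ℝ)
    (σ : Sph) (r R : ℝ) :
    stdIntegrand m δ α β Cs f f ξs Is ξ I σ r R = stdIntegrand m δ α β Cs f f ξ I ξs Is σ r R := by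
  simp only [stdIntegrand, xiPrimeStd, xiStarPrimeStd, IPrimeStd, IStarPrimeStd, collE_comm m ξ ξs,
    norm_sub_rev ξs ξ, add_comm ξs ξ, add_comm Is I, mul_comm Is I,
    add_comm (f ξs Is * f ξ I)]

theorem resonant_dissipation (m δ α β Cr : ℝ) (hm : 0 < m) (hCr : 0 ≤ Cr) (f : V3 → ℝ → ℝ)
    (hfpos : ∀ (ξ : V3) (I : ℝ), 0 < I → 0 < f ξ I)
    (hint : Integrable (fun p : V3 × ℝ × V3 × ℝ × Sph × ℝ =>
        resIntegrand δ α β Cr f f p.1 p.2.1 p.2.2.1 p.2.2.2.1 p.2.2.2.2.1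
            p.2.2.2.2.2 *
          Real.log (p.2.1 ^ (1 - δ / 2) * f p.1 p.2.1)) resMeasure) :
    Integrable (fun p => Qr δ α β Cr f f p.1 p.2 *
        Real.log (p.2 ^ (1 - δ / 2) * f p.1 p.2)) phaseMeasure ∧
      ∫ p, Qr δ α β Cr f f p.1 p.2 *
        Real.log (p.2 ^ (1 - δ / 2) * f p.1 p.2) ∂phaseMeasure ≤ 0 := by
  set G : ((V3 × ℝ) × (V3 × ℝ)) × (Sph × ℝ) → ℝ := fun x =>
    resIntegrand δ α β Cr f f x.1.1.1 x.1.1.2 x.1.2.1 x.1.2.2 x.2.1 x.2.2 with hGdef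
  set L : V3 × ℝ → ℝ := fun p => Real.log (p.2 ^ (1 - δ / 2) * f p.1 p.2)
  have hG : Integrable (fun x => G x * L x.1.1)
      ((phaseMeasure.prod phaseMeasure).prod resAngleMeasure) :=
    (measurePreserving_flatten_s2 resAngleMeasure).integrable_comp_fun hint
  obtain ⟨hi, he⟩ := integrable_and_integral_collision_mul hG (J := fun p q =>
    ∫ σ : Sph, (∫ r in Set.Icc (0 : ℝ) 1,
      resIntegrand δ α β Cr f f p.1 p.2 q.1 q.2 σ r) ∂sphMeasure)
    fun p q h => (integral_prod _ h).symm
  have hP : ∀ᵐ y ∂resConservedMeasure, 0 < y.2.1 ∧ 0 < y.2.2 := by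
    have h := ae_restrict_mem (μ := (volume : Measure ℝ)) (measurableSet_Ioi (a := (0 : ℝ)))
    filter_upwards [Measure.quasiMeasurePreserving_snd.ae (Measure.quasiMeasurePreserving_fst.ae h),
      Measure.quasiMeasurePreserving_snd.ae (Measure.quasiMeasurePreserving_snd.ae h)] with y h1 h2
    exact ⟨h1, h2⟩
  have hA : ∀ᵐ ω ∂resAngleMeasure, ω.2 ∈ Set.Ioo (0 : ℝ) 1 :=
    Measure.quasiMeasurePreserving_snd.ae ae_mem_Ioo_of_restrict_Icc
  have hpos : ∀ (y : V3 × ℝ × ℝ) (ω : Sph × ℝ), (0 < y.2.1 ∧ 0 < y.2.2) → ω.2 ∈ Set.Ioo (0 : ℝ) 1 →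
      0 < (resParam m (y, ω)).1.2 ∧ 0 < (resParam m (y, ω)).2.2 := fun y ω hy hω =>
    ⟨mul_pos hω.1 hy.2, mul_pos (sub_pos.2 hω.2) hy.2⟩
  have hle := integral_mul_nonpos_of_symm hG
    (fun p q ω => resIntegrand_comm δ α β Cr f p.1 p.2 q.1 q.2 ω.1 ω.2)
    (measurable_resJacobian m) (measurePreserving_resParam m hm)
    (S := fun y ω ω' => 2 * (4 / m * √(y.2.1 / m) * y.2.2 *
      (Cr * y.2.2 ^ α * (2 * √(y.2.1 / m)) ^ β * (y.2.2 * y.2.2) ^ (δ / 2 - 1)) *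
      ((ω.2 * (1 - ω.2)) ^ (δ / 2 - 1) * (ω'.2 * (1 - ω'.2)) ^ (δ / 2 - 1))))
    (d := pairDensity δ f) hP hA ?_ ?_ ?_ ?_ ?_
  · have hQ : ∀ p : V3 × ℝ, Qr δ α β Cr f f p.1 p.2 * L p = 1 / 2 *
        ((∫ Is in Set.Ici (0 : ℝ), ∫ ξs : V3, (∫ σ : Sph, (∫ r in Set.Icc (0 : ℝ) 1,
          resIntegrand δ α β Cr f f p.1 p.2 ξs Is σ r) ∂sphMeasure)) * L p) := fun p =>
      mul_assoc _ _ _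
    change Integrable (fun p : V3 × ℝ => Qr δ α β Cr f f p.1 p.2 * L p) phaseMeasure ∧
      ∫ p : V3 × ℝ, Qr δ α β Cr f f p.1 p.2 * L p ∂phaseMeasure ≤ 0
    simp only [hQ]
    refine ⟨hi.const_mul _, ?_⟩
    rw [integral_const_mul, he]
    linarith
  · rintro ⟨V, e, s⟩ ⟨σ, r⟩ ⟨σ', r'⟩ ⟨he0, hs0⟩ hr -
    simp only [hGdef]
    rw [resIntegrand_resParam, ← resJacobian_mul m δ α β Cr hm V e s he0 hs0 σ r r' hr]
    ring
  · intro y ω ω'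
    ring
  · rintro y ω ω' ⟨he0, hs0⟩ ⟨hr0, hr1⟩ ⟨hr0', hr1'⟩
    have := sub_pos.2 hr1
    have := sub_pos.2 hr1'
    positivity
  · exact fun y ω hy hω => pairDensity_pos hfpos (hpos y ω hy hω).1 (hpos y ω hy hω).2
  · exact fun y ω hy hω => log_add_log_eq_log_pairDensity hfpos (hpos y ω hy hω).1 (hpos y ω hy hω).2

theorem standard_dissipation (m δ α β Cs : ℝ) (hm : 0 < m) (hCs : 0 ≤ Cs) (f : V3 → ℝ → ℝ)
    (hfpos : ∀ (ξ : V3) (I : ℝ), 0 < I → 0 < f ξ I)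
    (hint : Integrable (fun p : V3 × ℝ × V3 × ℝ × Sph × ℝ × ℝ =>
        stdIntegrand m δ α β Cs f f p.1 p.2.1 p.2.2.1 p.2.2.2.1 p.2.2.2.2.1
            p.2.2.2.2.2.1 p.2.2.2.2.2.2 *
          Real.log (p.2.1 ^ (1 - δ / 2) * f p.1 p.2.1)) stdMeasure) :
    Integrable (fun p => Qs m δ α β Cs f f p.1 p.2 *
        Real.log (p.2 ^ (1 - δ / 2) * f p.1 p.2)) phaseMeasure ∧
      ∫ p, Qs m δ α β Cs f f p.1 p.2 *
        Real.log (p.2 ^ (1 - δ / 2) * f p.1 p.2) ∂phaseMeasure ≤ 0 := by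
  set G : ((V3 × ℝ) × (V3 × ℝ)) × (Sph × ℝ × ℝ) → ℝ := fun x =>
    stdIntegrand m δ α β Cs f f x.1.1.1 x.1.1.2 x.1.2.1 x.1.2.2 x.2.1 x.2.2.1 x.2.2.2 with hGdef
  set L : V3 × ℝ → ℝ := fun p => Real.log (p.2 ^ (1 - δ / 2) * f p.1 p.2)
  have hG : Integrable (fun x => G x * L x.1.1)
      ((phaseMeasure.prod phaseMeasure).prod stdAngleMeasure) :=
    (measurePreserving_flatten_s2 stdAngleMeasure).integrable_comp_fun hint
  obtain ⟨hi, he⟩ := integrable_and_integral_collision_mul hG (J := fun p q =>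
    ∫ σ : Sph, (∫ r in Set.Icc (0 : ℝ) 1, ∫ R in Set.Icc (0 : ℝ) 1,
      stdIntegrand m δ α β Cs f f p.1 p.2 q.1 q.2 σ r R) ∂sphMeasure) <| by
    intro p q h
    rw [stdAngleMeasure] at h ⊢
    rw [integral_prod _ h]
    refine integral_congr_ae ?_
    filter_upwards [h.prod_right_ae] with σ hσ
    exact (integral_prod _ hσ).symm
  have hP : ∀ᵐ y ∂stdConservedMeasure, 0 < y.2 :=
    Measure.quasiMeasurePreserving_snd.ae (ae_restrict_mem measurableSet_Ioi)
  have hA : ∀ᵐ ω ∂stdAngleMeasure, ω.2.1 ∈ Set.Ioo (0 : ℝ) 1 ∧ ω.2.2 ∈ Set.Ioo (0 : ℝ) 1 := by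
    filter_upwards [Measure.quasiMeasurePreserving_snd.ae
        (Measure.quasiMeasurePreserving_fst.ae ae_mem_Ioo_of_restrict_Icc),
      Measure.quasiMeasurePreserving_snd.ae
        (Measure.quasiMeasurePreserving_snd.ae ae_mem_Ioo_of_restrict_Icc)] with ω h1 h2
    exact ⟨h1, h2⟩
  have hpos : ∀ (y : V3 × ℝ) (ω : Sph × ℝ × ℝ), 0 < y.2 →
      (ω.2.1 ∈ Set.Ioo (0 : ℝ) 1 ∧ ω.2.2 ∈ Set.Ioo (0 : ℝ) 1) →
      0 < (stdParam m (y, ω)).1.2 ∧ 0 < (stdParam m (y, ω)).2.2 := fun y ω hy hω =>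
    have hs := mul_pos (sub_pos.2 hω.2.2) hy
    ⟨mul_pos hω.1.1 hs, mul_pos (sub_pos.2 hω.1.2) hs⟩
  have hle := integral_mul_nonpos_of_symm hG
    (fun p q ω => stdIntegrand_comm m δ α β Cs f p.1 p.2 q.1 q.2 ω.1 ω.2.1 ω.2.2)
    (measurable_stdJacobian m) (measurePreserving_stdParam m hm)
    (S := fun y ω ω' => 2 * (y.2 * (4 / m) * Cs * y.2 ^ (α + δ - 1) * 2 ^ β *
      (y.2 / m) ^ ((β + 1) / 2) * (stdWeight δ α β ω * stdWeight δ α β ω')))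
    (d := pairDensity δ f) hP hA ?_ ?_ ?_ ?_ ?_
  · have hQ : ∀ p : V3 × ℝ, Qs m δ α β Cs f f p.1 p.2 * L p = 1 / 2 *
        ((∫ Is in Set.Ici (0 : ℝ), ∫ ξs : V3, (∫ σ : Sph, (∫ r in Set.Icc (0 : ℝ) 1,
          ∫ R in Set.Icc (0 : ℝ) 1,
            stdIntegrand m δ α β Cs f f p.1 p.2 ξs Is σ r R) ∂sphMeasure)) * L p) := fun p =>
      mul_assoc _ _ _
    change Integrable (fun p : V3 × ℝ => Qs m δ α β Cs f f p.1 p.2 * L p) phaseMeasure ∧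
      ∫ p : V3 × ℝ, Qs m δ α β Cs f f p.1 p.2 * L p ∂phaseMeasure ≤ 0
    simp only [hQ]
    refine ⟨hi.const_mul _, ?_⟩
    rw [integral_const_mul, he]
    linarith
  · rintro ⟨V, E⟩ ⟨σ, r, R⟩ ⟨σ', r', R'⟩ hE ⟨hr, hR⟩ -
    simp only [hGdef]
    rw [stdIntegrand_stdParam m δ α β Cs hm f V E hE σ σ' r r' R R' hR.1.le,
      ← stdJacobian_mul m δ α β Cs hm V E hE σ σ' r r' R R' hr hR]
    ring
  · intro y ω ω'
    ring
  · rintro y ω ω' hE ⟨⟨hr0, hr1⟩, hR0, hR1⟩ ⟨⟨hr0', hr1'⟩, hR0', hR1'⟩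
    have := sub_pos.2 hr1
    have := sub_pos.2 hr1'
    have := sub_pos.2 hR1
    have := sub_pos.2 hR1'
    unfold stdWeight
    positivity
  · exact fun y ω hy hω => pairDensity_pos hfpos (hpos y ω hy hω).1 (hpos y ω hy hω).2
  · exact fun y ω hy hω => log_add_log_eq_log_pairDensity hfpos (hpos y ω hy hω).1 (hpos y ω hy hω).2

/-- the entropy-dissipation functional `W_θ[f]` is nonpositive. -/
theorem entropy_dissipation_nonpos (m kB δ α β Cr Cs : ℝ) (hm : 0 < m) (hkB : 0 < kB) (hδ : 2 ≤ δ)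
    (hα : α ∈ Set.Ico (0:ℝ) (δ / 2)) (hβ : β ∈ Set.Icc (0:ℝ) 1) (hCr : 0 < Cr)
    (hCs : Cs = Real.Gamma (δ + α + (β + 3) / 2) /
      (Real.Gamma ((β + 3) / 2) * Real.Gamma (δ + α)) * Cr) (θ : ℝ) (hθ : θ ∈ Set.Icc (0:ℝ) 1)
    (f : V3 → ℝ → ℝ) (hf : Measurable (Function.uncurry f))
    (hfpos : ∀ (ξ : V3) (I : ℝ), 0 < I → 0 < f ξ I)
    (hint : Integrable (fun p : V3 × ℝ =>
        (θ * Qs m δ α β Cs f f p.1 p.2 + (1 - θ) * Qr δ α β Cr f f p.1 p.2) *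
          Real.log (p.2 ^ (1 - δ / 2) * f p.1 p.2)) phaseMeasure)
    (hintS : Integrable (fun p : V3 × ℝ × V3 × ℝ × Sph × ℝ × ℝ =>
        stdIntegrand m δ α β Cs f f p.1 p.2.1 p.2.2.1 p.2.2.2.1 p.2.2.2.2.1
            p.2.2.2.2.2.1 p.2.2.2.2.2.2 *
          Real.log (p.2.1 ^ (1 - δ / 2) * f p.1 p.2.1)) stdMeasure)
    (hintR : Integrable (fun p : V3 × ℝ × V3 × ℝ × Sph × ℝ =>
        resIntegrand δ α β Cr f f p.1 p.2.1 p.2.2.1 p.2.2.2.1 p.2.2.2.2.1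
            p.2.2.2.2.2 *
          Real.log (p.2.1 ^ (1 - δ / 2) * f p.1 p.2.1)) resMeasure) :
    (∫ p, (θ * Qs m δ α β Cs f f p.1 p.2 + (1 - θ) * Qr δ α β Cr f f p.1 p.2) *
        Real.log (p.2 ^ (1 - δ / 2) * f p.1 p.2) ∂phaseMeasure) ≤ 0 := by
  have hα0 := hα.1
  have hβ0 := hβ.1
  have hCs0 : 0 ≤ Cs := by
    have h1 := Real.Gamma_pos_of_pos (s := δ + α + (β + 3) / 2) (by linarith)
    have h2 := Real.Gamma_pos_of_pos (s := (β + 3) / 2) (by linarith)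
    have h3 := Real.Gamma_pos_of_pos (s := δ + α) (by linarith)
    rw [hCs]
    positivity
  obtain ⟨hs, hs0⟩ := standard_dissipation m δ α β Cs hm hCs0 f hfpos hintS
  obtain ⟨hr, hr0⟩ := resonant_dissipation m δ α β Cr hm hCr.le f hfpos hintR
  simp only [add_mul, mul_assoc]
  rw [integral_add (hs.const_mul θ) (hr.const_mul (1 - θ)), integral_const_mul, integral_const_mul]
  linarith [mul_nonpos_of_nonneg_of_nonpos hθ.1 hs0,
    mul_nonpos_of_nonneg_of_nonpos (sub_nonneg.2 hθ.2) hr0]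
end
end

section
/- The two-temperature equilibrium distribution annihilates the resonant collision operator: for all ξ ∈ ℝ³ and all I > 0, Q_r(M_r, M_r)(ξ, I) = 0. -/
noncomputable section

open MeasureTheory Real
open scoped BigOperators RealInnerProductSpace

/-- Resonant collisions conserve the kinetic energy measured from any reference velocity `u`. -/
lemma norm_sq_xiPrimeRes_add_norm_sq_xiStarPrimeRes (ξ ξs u : V3) (σ : Sph) :
    ‖xiPrimeRes ξ ξs σ - u‖ ^ 2 + ‖xiStarPrimeRes ξ ξs σ - u‖ ^ 2 =
      ‖ξ - u‖ ^ 2 + ‖ξs - u‖ ^ 2 := by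
  set A : V3 := (1 / 2 : ℝ) • (ξ + ξs) - u with hA
  set B : V3 := (‖ξ - ξs‖ / 2) • (σ : V3) with hB
  set D : V3 := (1 / 2 : ℝ) • (ξ - ξs) with hD
  have hBn : ‖B‖ = ‖D‖ := by
    rw [hB, hD, norm_smul, norm_smul, mem_sphere_zero_iff_norm.1 σ.2]
    simp only [norm_div, norm_norm, norm_one, Real.norm_ofNat]
    ring
  have h1 : xiPrimeRes ξ ξs σ - u = A + B := by
    simp only [xiPrimeRes, hA, hB]; abel
  have h2 : xiStarPrimeRes ξ ξs σ - u = A - B := by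
    simp only [xiStarPrimeRes, hA, hB]; abel
  have h3 : ξ - u = A + D := by
    simp only [hA, hD]; module
  have h4 : ξs - u = A - D := by
    simp only [hA, hD]; module
  have hAB := parallelogram_law_with_norm ℝ A B
  have hAD := parallelogram_law_with_norm ℝ A D
  rw [hBn] at hAB
  rw [h1, h2, h3, h4]
  linarith

/-- A product of two values of `M_r` depends on the velocities and internal energies only through
the kinetic energy, the total internal energy and the product of the internal energies. -/
lemma Mr_mul_Mr (m kB δ n Ttr Tint : ℝ) (u ξ ξs : V3) {I Is : ℝ} (hI : 0 ≤ I) (hIs : 0 ≤ Is) :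
    Mr m kB δ n Ttr Tint u ξ I * Mr m kB δ n Ttr Tint u ξs Is =
      (n / ((2 * π * kB * Ttr / m) ^ ((3 : ℝ) / 2) * (kB * Tint) ^ (δ / 2) *
          Real.Gamma (δ / 2))) ^ 2 *
        Real.exp (-(m * (‖ξ - u‖ ^ 2 + ‖ξs - u‖ ^ 2)) / (2 * kB * Ttr) - (I + Is) / (kB * Tint)) *
        (I * Is) ^ (δ / 2 - 1) := by
  have hexp : Real.exp (-(m * (‖ξ - u‖ ^ 2 + ‖ξs - u‖ ^ 2)) / (2 * kB * Ttr) -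
        (I + Is) / (kB * Tint)) =
      Real.exp (-(m * ‖ξ - u‖ ^ 2) / (2 * kB * Ttr) - I / (kB * Tint)) *
        Real.exp (-(m * ‖ξs - u‖ ^ 2) / (2 * kB * Ttr) - Is / (kB * Tint)) := by
    rw [← Real.exp_add]
    congr 1
    ring
  rw [hexp, Real.mul_rpow hI hIs, Mr, Mr]
  ring

lemma resIntegrand_Mr_eq_zero (m kB δ α β Cr n Ttr Tint : ℝ) (u ξ ξs : V3) {I Is r : ℝ}
    (hI : 0 < I) (hIs : 0 ≤ Is) (hr : r ∈ Set.Icc (0 : ℝ) 1) (σ : Sph) :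
    resIntegrand δ α β Cr (Mr m kB δ n Ttr Tint u) (Mr m kB δ n Ttr Tint u) ξ I ξs Is σ r = 0 := by
  have hr' : 0 ≤ 1 - r := sub_nonneg.2 hr.2
  have hsum : 0 < I + Is := by linarith
  have hI' : 0 ≤ IPrimeRes I Is r := mul_nonneg hr.1 hsum.le
  have hIs' : 0 ≤ IStarPrimeRes I Is r := mul_nonneg hr' hsum.le
  have hadd : IPrimeRes I Is r + IStarPrimeRes I Is r = I + Is := by
    simp only [IPrimeRes, IStarPrimeRes]; ring
  have hpow : (IPrimeRes I Is r * IStarPrimeRes I Is r) ^ (δ / 2 - 1) =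
      (r * (1 - r)) ^ (δ / 2 - 1) * ((I + Is) ^ 2) ^ (δ / 2 - 1) := by
    rw [← Real.mul_rpow (mul_nonneg hr.1 hr') (sq_nonneg _)]
    simp only [IPrimeRes, IStarPrimeRes]
    congr 1
    ring
  unfold resIntegrand
  rw [mul_comm (Mr _ _ _ _ _ _ _ (xiStarPrimeRes ξ ξs σ) _), mul_comm (Mr _ _ _ _ _ _ _ ξs _),
    Mr_mul_Mr _ _ _ _ _ _ _ _ _ hI' hIs', Mr_mul_Mr _ _ _ _ _ _ _ _ _ hI.le hIs, hadd,
    norm_sq_xiPrimeRes_add_norm_sq_xiStarPrimeRes, hpow]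
  have hs : ((I + Is) ^ 2) ^ (δ / 2 - 1) ≠ 0 := (Real.rpow_pos_of_pos (pow_pos hsum 2) _).ne'
  generalize ((I + Is) ^ 2) ^ (δ / 2 - 1) = s at hs
  generalize (r * (1 - r)) ^ (δ / 2 - 1) = w
  generalize (I * Is) ^ (δ / 2 - 1) = p
  rcases eq_or_ne w 0 with rfl | hw
  · simp
  rcases eq_or_ne p 0 with rfl | hp
  · simp
  field_simp
  ring

/-- the two-temperature equilibrium annihilates the resonant collision
operator. -/
theorem Qr_twoTemp_eq_zero (m kB δ α β Cr : ℝ) (hm : 0 < m) (hkB : 0 < kB) (hδ : 2 ≤ δ)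
    (hα : α ∈ Set.Ico (0:ℝ) (δ / 2)) (hβ : β ∈ Set.Icc (0:ℝ) 1) (hCr : 0 < Cr)
    (n Ttr Tint : ℝ) (hn : 0 < n) (hTtr : 0 < Ttr) (hTint : 0 < Tint) (u : V3) :
    ∀ (ξ : V3) (I : ℝ), 0 < I →
      Qr δ α β Cr (Mr m kB δ n Ttr Tint u) (Mr m kB δ n Ttr Tint u) ξ I = 0 := by
  intro ξ I hI
  have h : ∀ Is ∈ Set.Ici (0 : ℝ), (∫ ξs : V3, (∫ σ : Sph, (∫ r in Set.Icc (0 : ℝ) 1,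
      resIntegrand δ α β Cr (Mr m kB δ n Ttr Tint u) (Mr m kB δ n Ttr Tint u) ξ I ξs Is σ r)
        ∂sphMeasure)) = 0 := fun Is hIs => by
    have h' : ∀ (ξs : V3) (σ : Sph), (∫ r in Set.Icc (0 : ℝ) 1,
        resIntegrand δ α β Cr (Mr m kB δ n Ttr Tint u) (Mr m kB δ n Ttr Tint u)
          ξ I ξs Is σ r) = 0 := fun ξs σ =>
      setIntegral_eq_zero_of_forall_eq_zero fun r hr =>
        resIntegrand_Mr_eq_zero m kB δ α β Cr n Ttr Tint u ξ ξs hI hIs hr σ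
    simp [h']
  rw [Qr, setIntegral_eq_zero_of_forall_eq_zero h, mul_zero]
end
end

section
/- Suppose T_tr ≠ T_int and set ζ = k_B T_tr T_int / |T_tr − T_int| and η = sign(T_tr − T_int) ∈ {−1, 1}. Then for all standard Borgnakke–Larsen collision variables with I > 0, I_* > 0, I' > 0, I_*' > 0, the pointwise identity M_r(ξ',I') M_r(ξ_*',I_*') · (I I_* / (I' I_*'))^{δ/2−1} − M_r(ξ,I) M_r(ξ_*,I_*) = M_s^{tr}(ξ,I) M_s^{tr}(ξ_*,I_*) · (T_tr/T_int)^δ · ( e^{−η(I'+I_*')/ζ} − e^{−η(I+I_*)/ζ} ) holds, where M_s^{tr} denotes the Maxwellian at temperature T_tr. -/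
noncomputable section

open MeasureTheory Real
open scoped BigOperators RealInnerProductSpace

/-- The two-temperature distribution is the Maxwellian at the translational temperature times a
Boltzmann factor in the internal energy. -/
lemma Mr_eq_Ms_mul_exp {m kB δ n Ttr Tint : ℝ} (hkB : 0 < kB) (hTtr : 0 < Ttr)
    (hTint : 0 < Tint) (u ξ : V3) (I : ℝ) :
    Mr m kB δ n Ttr Tint u ξ I =
      Ms m kB δ n Ttr u ξ I * (Ttr / Tint) ^ (δ / 2) *
        Real.exp (-((Ttr - Tint) / (kB * Ttr * Tint)) * I) := by
  have hexp : Real.exp (-(m * ‖ξ - u‖ ^ 2) / (2 * kB * Ttr) - I / (kB * Tint)) =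
      Real.exp (-(m * ‖ξ - u‖ ^ 2 + 2 * I) / (2 * kB * Ttr)) *
        Real.exp (-((Ttr - Tint) / (kB * Ttr * Tint)) * I) := by
    rw [← Real.exp_add]
    congr 1
    field_simp
    ring
  have hTtr' : Ttr ^ (δ / 2) ≠ 0 := (Real.rpow_pos_of_pos hTtr _).ne'
  unfold Mr Ms
  rw [hexp, Real.div_rpow hTtr.le hTint.le, Real.mul_rpow hkB.le hTint.le,
    Real.mul_rpow hkB.le hTtr.le]
  generalize Real.exp (-(m * ‖ξ - u‖ ^ 2 + 2 * I) / (2 * kB * Ttr)) = e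
  generalize (2 * π * kB * Ttr / m) ^ ((3 : ℝ) / 2) = c
  field_simp

/-- Parallelogram identity around the center of mass. -/
lemma norm_sq_add_norm_sq_sub_eq (ξ ξs u : V3) :
    ‖ξ - u‖ ^ 2 + ‖ξs - u‖ ^ 2 =
      2 * ‖(1 / 2 : ℝ) • (ξ + ξs) - u‖ ^ 2 + ‖ξ - ξs‖ ^ 2 / 2 := by
  have h := parallelogram_law_with_norm ℝ (ξ - u) (ξs - u)
  have h1 : ξ - u + (ξs - u) = (2 : ℝ) • ((1 / 2 : ℝ) • (ξ + ξs) - u) := by module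
  rw [h1, sub_sub_sub_cancel_right, norm_smul, Real.norm_ofNat] at h
  linarith

lemma IPrimeStd_add_IStarPrimeStd (m : ℝ) (ξ ξs : V3) (I Is R r : ℝ) :
    IPrimeStd m ξ ξs I Is R r + IStarPrimeStd m ξ ξs I Is R r =
      (1 - R) * collE m ξ ξs I Is := by
  unfold IPrimeStd IStarPrimeStd
  ring

/-- Conservation of total energy in a standard collision. -/
lemma energy_conservation_std {m : ℝ} (hm : 0 < m) (u ξ ξs : V3) {I Is R : ℝ} (r : ℝ) (σ : Sph)
    (hR : 0 ≤ R) (hI : 0 ≤ I) (hIs : 0 ≤ Is) :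
    (m * ‖xiPrimeStd m ξ ξs I Is R σ - u‖ ^ 2 + 2 * IPrimeStd m ξ ξs I Is R r) +
        (m * ‖xiStarPrimeStd m ξ ξs I Is R σ - u‖ ^ 2 + 2 * IStarPrimeStd m ξ ξs I Is R r) =
      (m * ‖ξ - u‖ ^ 2 + 2 * I) + (m * ‖ξs - u‖ ^ 2 + 2 * Is) := by
  have hE : 0 ≤ collE m ξ ξs I Is := by unfold collE; positivity
  have hs : m * √(R * collE m ξ ξs I Is / m) ^ 2 = R * collE m ξ ξs I Is := by
    rw [Real.sq_sqrt (by positivity)]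
    field_simp
  have hσ : ‖(σ : V3)‖ = 1 := norm_eq_of_mem_sphere σ
  have hpost := norm_sq_add_norm_sq_sub_eq (xiPrimeStd m ξ ξs I Is R σ)
    (xiStarPrimeStd m ξ ξs I Is R σ) u
  have hmid : (1 / 2 : ℝ) • (xiPrimeStd m ξ ξs I Is R σ + xiStarPrimeStd m ξ ξs I Is R σ) =
      (1 / 2 : ℝ) • (ξ + ξs) := by
    unfold xiPrimeStd xiStarPrimeStd
    module
  have hdiff : xiPrimeStd m ξ ξs I Is R σ - xiStarPrimeStd m ξ ξs I Is R σ =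
      (2 * √(R * collE m ξ ξs I Is / m)) • (σ : V3) := by
    unfold xiPrimeStd xiStarPrimeStd
    module
  rw [hmid, hdiff, norm_smul, hσ, mul_one, Real.norm_eq_abs, sq_abs] at hpost
  have hpre := norm_sq_add_norm_sq_sub_eq ξ ξs u
  have hII := IPrimeStd_add_IStarPrimeStd m ξ ξs I Is R r
  have hEdef : collE m ξ ξs I Is = m / 4 * ‖ξ - ξs‖ ^ 2 + I + Is := rfl
  linear_combination m * hpost - m * hpre + 2 * hII + 2 * hs + 2 * hEdef

/-- Detailed balance for the Maxwellian, as a consequence of energy conservation. -/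
lemma Ms_mul_Ms_eq_of_energy_eq {m kB δ n T : ℝ} {u ξ ξs ξ' ξs' : V3} {I Is I' Is' : ℝ}
    (hI : 0 < I) (hIs : 0 < Is) (hI' : 0 < I') (hIs' : 0 < Is')
    (h : (m * ‖ξ' - u‖ ^ 2 + 2 * I') + (m * ‖ξs' - u‖ ^ 2 + 2 * Is') =
      (m * ‖ξ - u‖ ^ 2 + 2 * I) + (m * ‖ξs - u‖ ^ 2 + 2 * Is)) :
    Ms m kB δ n T u ξ' I' * Ms m kB δ n T u ξs' Is' * (I * Is / (I' * Is')) ^ (δ / 2 - 1) =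
      Ms m kB δ n T u ξ I * Ms m kB δ n T u ξs Is := by
  have hexp : Real.exp (-(m * ‖ξ' - u‖ ^ 2 + 2 * I') / (2 * kB * T)) *
        Real.exp (-(m * ‖ξs' - u‖ ^ 2 + 2 * Is') / (2 * kB * T)) =
      Real.exp (-(m * ‖ξ - u‖ ^ 2 + 2 * I) / (2 * kB * T)) *
        Real.exp (-(m * ‖ξs - u‖ ^ 2 + 2 * Is) / (2 * kB * T)) := by
    rw [← Real.exp_add, ← Real.exp_add, ← add_div, ← add_div, ← neg_add, ← neg_add, h]
  have hpow : I' ^ (δ / 2 - 1) * Is' ^ (δ / 2 - 1) * (I * Is / (I' * Is')) ^ (δ / 2 - 1) =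
      I ^ (δ / 2 - 1) * Is ^ (δ / 2 - 1) := by
    rw [← Real.mul_rpow hI'.le hIs'.le, ← Real.mul_rpow (by positivity) (by positivity),
      mul_div_cancel₀ _ (by positivity), Real.mul_rpow hI.le hIs.le]
  unfold Ms
  set c := (2 * π * kB * T / m) ^ ((3 : ℝ) / 2) * (kB * T) ^ (δ / 2) * Real.Gamma (δ / 2)
  simp only [div_eq_mul_inv _ c]
  calc _ = (n * c⁻¹) ^ 2 *
        (I' ^ (δ / 2 - 1) * Is' ^ (δ / 2 - 1) * (I * Is / (I' * Is')) ^ (δ / 2 - 1)) *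
        (Real.exp (-(m * ‖ξ' - u‖ ^ 2 + 2 * I') / (2 * kB * T)) *
          Real.exp (-(m * ‖ξs' - u‖ ^ 2 + 2 * Is') / (2 * kB * T))) := by ring
    _ = _ := by rw [hexp, hpow]; ring

lemma sign_div_eq_inverse_temperature_gap {kB Ttr Tint : ℝ} (hne : Ttr ≠ Tint) :
    (if Tint < Ttr then (1 : ℝ) else -1) / (kB * Ttr * Tint / |Ttr - Tint|) =
      (Ttr - Tint) / (kB * Ttr * Tint) := by
  rw [div_div_eq_mul_div]
  split_ifs with h
  · rw [abs_of_pos (sub_pos.2 h), one_mul]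
  · rw [abs_of_neg (sub_neg.2 (lt_of_le_of_ne (not_lt.1 h) hne)), neg_one_mul, neg_neg]

/-- pointwise factorization identity for the two-temperature equilibrium
along standard collision variables. -/
theorem twoTemp_pointwise_identity (m kB δ n Ttr Tint : ℝ)
    (hm : 0 < m) (hkB : 0 < kB) (hδ : 2 ≤ δ) (hn : 0 < n)
    (hTtr : 0 < Ttr) (hTint : 0 < Tint) (hne : Ttr ≠ Tint) (u : V3)
    (ζ η : ℝ) (hζ : ζ = kB * Ttr * Tint / |Ttr - Tint|)
    (hη : η = if Tint < Ttr then 1 else -1) :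
    ∀ (ξ ξs : V3) (I Is R r : ℝ) (σ : Sph),
      R ∈ Set.Icc (0:ℝ) 1 → r ∈ Set.Icc (0:ℝ) 1 →
      0 < I → 0 < Is →
      0 < IPrimeStd m ξ ξs I Is R r → 0 < IStarPrimeStd m ξ ξs I Is R r →
      Mr m kB δ n Ttr Tint u (xiPrimeStd m ξ ξs I Is R σ) (IPrimeStd m ξ ξs I Is R r) *
          Mr m kB δ n Ttr Tint u (xiStarPrimeStd m ξ ξs I Is R σ)
            (IStarPrimeStd m ξ ξs I Is R r) *
          (I * Is / (IPrimeStd m ξ ξs I Is R r * IStarPrimeStd m ξ ξs I Is R r)) ^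
            (δ / 2 - 1) -
        Mr m kB δ n Ttr Tint u ξ I * Mr m kB δ n Ttr Tint u ξs Is =
      Ms m kB δ n Ttr u ξ I * Ms m kB δ n Ttr u ξs Is * (Ttr / Tint) ^ δ *
        (Real.exp (-η * (IPrimeStd m ξ ξs I Is R r + IStarPrimeStd m ξ ξs I Is R r) / ζ) -
          Real.exp (-η * (I + Is) / ζ)) := by
  intro ξ ξs I Is R r σ hR _ hI hIs hI' hIs'
  have hbal := Ms_mul_Ms_eq_of_energy_eq (kB := kB) (δ := δ) (n := n) (T := Ttr) hI hIs hI' hIs'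
    (energy_conservation_std hm u ξ ξs r σ hR.1 hI.le hIs.le)
  have hb : η / ζ = (Ttr - Tint) / (kB * Ttr * Tint) := by
    rw [hη, hζ, sign_div_eq_inverse_temperature_gap hne]
  have hpow : (Ttr / Tint) ^ δ = (Ttr / Tint) ^ (δ / 2) * (Ttr / Tint) ^ (δ / 2) := by
    rw [← Real.rpow_add (div_pos hTtr hTint), add_halves]
  have hexp (x y : ℝ) : Real.exp (-η * (x + y) / ζ) =
      Real.exp (-(η / ζ) * x) * Real.exp (-(η / ζ) * y) := by
    rw [← Real.exp_add]
    congr 1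
    ring
  simp only [Mr_eq_Ms_mul_exp hkB hTtr hTint, ← hb, hexp, hpow]
  linear_combination (Ttr / Tint) ^ (δ / 2) * (Ttr / Tint) ^ (δ / 2) *
    Real.exp (-(η / ζ) * IPrimeStd m ξ ξs I Is R r) *
    Real.exp (-(η / ζ) * IStarPrimeStd m ξ ξs I Is R r) * hbal
end
end
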